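/- arXiv:math/0108200 — 10 statements merged into one kernel-verified Lean document; each statement's English description precedes it below -/
import Mathlib

section
/- Let p and q be complex polynomials with q ≠ 0 and deg p > deg q (so that the rational function R = p/q satisfies R(∞) = ∞), and let c > 0. Let Ω ⊆ ℂ be a nonempty bounded open connected set such that q has no zeros on the closure of Ω, p has no zeros on ℂ ∖ Ω, and the frontier of Ω is contained in the lemniscate {z : ‖p(z)/q(z)‖ = c}. Then, setting f(z) := p(z)/q(z) and g(z) := c^2 · q(z)/p(z), the pair (f, g) is a matching pair for Ω, and f is nonconstant on Ω. -/
open Metric Polynomial Filter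

/-- A matching pair for a bounded open set `Ω ⊆ ℂ`: `f` is continuous on `closure Ω` and
holomorphic in `Ω`, `g` is continuous on `ℂ ∖ Ω`, holomorphic in the exterior
`ℂ ∖ closure Ω`, `g` vanishes at infinity, and `f = conj g` on the boundary `frontier Ω`. -/
def IsMatchingPair (Ω : Set ℂ) (f g : ℂ → ℂ) : Prop :=
  ContinuousOn f (closure Ω) ∧ (∀ z ∈ Ω, DifferentiableAt ℂ f z) ∧
  ContinuousOn g Ωᶜ ∧ (∀ z ∈ (closure Ω)ᶜ, DifferentiableAt ℂ g z) ∧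
  Tendsto g (cocompact ℂ) (nhds 0) ∧
  ∀ z ∈ frontier Ω, f z = (starRingEnd ℂ) (g z)

/-- Melnikov's theorem (Theorem 2.1): lemniscates admit nontrivial solutions of the
matching problem. -/
theorem melnikov_lemniscate_matching
    (p q : Polynomial ℂ) (hq : q ≠ 0) (hdeg : q.degree < p.degree)
    (c : ℝ) (hc : 0 < c)
    (Ω : Set ℂ) (hΩne : Ω.Nonempty) (hΩb : Bornology.IsBounded Ω)
    (hΩo : IsOpen Ω) (hΩc : IsConnected Ω)
    (hqz : ∀ z ∈ closure Ω, q.eval z ≠ 0)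
    (hpz : ∀ z ∉ Ω, p.eval z ≠ 0)
    (hfr : frontier Ω ⊆ {z : ℂ | ‖p.eval z / q.eval z‖ = c}) :
    IsMatchingPair Ω (fun z => p.eval z / q.eval z)
      (fun z => (c : ℂ) ^ 2 * q.eval z / p.eval z) ∧
    ¬ ∃ k : ℂ, ∀ z ∈ Ω, p.eval z / q.eval z = k := by
  refine ⟨⟨?_, ?_, ?_, ?_, ?_, ?_⟩, ?_⟩
  · exact p.continuous.continuousOn.div q.continuous.continuousOn hqz
  · exact fun z hz => p.differentiableAt.div q.differentiableAt (hqz z (subset_closure hz))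
  · exact (continuousOn_const.mul q.continuous.continuousOn).div p.continuous.continuousOn hpz
  · exact fun z hz => (q.differentiableAt.const_mul _).div p.differentiableAt
      (hpz z fun h => hz (subset_closure h))
  · have := (isLittleO_cobounded_of_degree_lt hdeg).tendsto_div_nhds_zero.const_mul ((c : ℂ) ^ 2)
    simpa only [mul_zero, mul_div_assoc, ← cobounded_eq_cocompact] using this
  · intro z hz
    have hzc : ‖p.eval z / q.eval z‖ = c := hfr hz
    have hne : p.eval z / q.eval z ≠ 0 := norm_pos_iff.mp (hzc ▸ hc)
    have hg : (c : ℂ) ^ 2 * q.eval z / p.eval z = (starRingEnd ℂ) (p.eval z / q.eval z) := by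
      rw [mul_div_assoc, ← inv_div (p.eval z), ← div_eq_mul_inv, div_eq_iff hne, ← hzc,
        Complex.conj_mul']
    exact (Complex.conj_conj _).symm.trans (congrArg _ hg.symm)
  · rintro ⟨k, hk⟩
    obtain ⟨w, hw⟩ := hΩne
    have hpq : p = C k * q := eq_of_infinite_eval_eq _ _ <|
      (infinite_of_mem_nhds w (hΩo.mem_nhds hw)).mono fun z hz => by
        simpa using (div_eq_iff (hqz z (subset_closure hz))).mp (hk z hz)
    exact (hpq ▸ hdeg).not_ge (smul_eq_C_mul (p := q) k ▸ degree_smul_le k q)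
end

section
/- Let p and q be coprime complex polynomials with max(deg p, deg q) ≥ 2, let U ⊆ ℂ be an open set containing the closed unit disk on which q has no zeros, and suppose the rational function φ := p/q is injective on U. Set Ω := φ '' (ball 0 1), the image of the open unit disk under φ (an R-domain of degree ≥ 2). Then for every matching pair (f, g) for Ω, the function f is constant on Ω. -/
open Metric Polynomial Filter

/-- Holomorphy of Cauchy-type integrals off the image of the contour. -/
lemma differentiableAt_circleIntegral_div_sub {u v : ℂ → ℂ} {R : ℝ} (hR : 0 ≤ R)
    (hu : ContinuousOn u (sphere 0 R)) (hv : ContinuousOn v (sphere 0 R)) {w : ℂ}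
    (hw : w ∉ v '' sphere 0 R) :
    DifferentiableAt ℂ (fun w ↦ ∮ ζ in C(0, R), u ζ / (v ζ - w)) w := by
  have hcm : ∀ θ, circleMap 0 R θ ∈ sphere (0 : ℂ) R := fun θ ↦ circleMap_mem_sphere 0 hR θ
  have hu' : Continuous fun θ ↦ u (circleMap 0 R θ) :=
    hu.comp_continuous (continuous_circleMap 0 R) hcm
  have hv' : Continuous fun θ ↦ v (circleMap 0 R θ) :=
    hv.comp_continuous (continuous_circleMap 0 R) hcm
  have hd : Continuous fun θ ↦ deriv (circleMap 0 R) θ := by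
    simp only [deriv_circleMap]
    exact (continuous_circleMap 0 R).mul continuous_const
  have hcpt : IsCompact (v '' sphere 0 R) := (isCompact_sphere 0 R).image_of_continuousOn hv
  obtain ⟨δ, hδ, hball⟩ := Metric.isOpen_iff.1 hcpt.isClosed.isOpen_compl w hw
  have hlow : ∀ x ∈ ball w (δ / 2), ∀ θ, δ / 2 ≤ ‖v (circleMap 0 R θ) - x‖ := by
    intro x hx θ
    by_contra! h
    rw [← dist_eq_norm] at h
    have hmem : v (circleMap 0 R θ) ∈ ball w δ := by
      rw [mem_ball] at hx ⊢
      linarith [dist_triangle (v (circleMap 0 R θ)) x w]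
    exact hball hmem ⟨_, hcm θ, rfl⟩
  have hne : ∀ x ∈ ball w (δ / 2), ∀ θ, v (circleMap 0 R θ) - x ≠ 0 := fun x hx θ h ↦ by
    have := hlow x hx θ
    rw [h, norm_zero] at this
    linarith
  have hcont : ∀ x ∈ ball w (δ / 2), Continuous fun θ ↦
      deriv (circleMap 0 R) θ • (u (circleMap 0 R θ) / (v (circleMap 0 R θ) - x)) := fun x hx ↦
    hd.smul (hu'.div (hv'.sub continuous_const) (hne x hx))
  have hmem : ball w (δ / 2) ∈ nhds w := ball_mem_nhds w (half_pos hδ)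
  have key := intervalIntegral.hasDerivAt_integral_of_dominated_loc_of_deriv_le
    (μ := MeasureTheory.volume) (a := 0) (b := 2 * Real.pi)
    (F := fun x θ ↦ deriv (circleMap 0 R) θ • (u (circleMap 0 R θ) / (v (circleMap 0 R θ) - x)))
    (F' := fun x θ ↦
      deriv (circleMap 0 R) θ • (u (circleMap 0 R θ) / (v (circleMap 0 R θ) - x) ^ 2))
    (bound := fun θ ↦ ‖deriv (circleMap 0 R) θ‖ * (‖u (circleMap 0 R θ)‖ / (δ / 2) ^ 2))
    hmem ?_ ?_ ?_ ?_ ?_ ?_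
  · exact key.2.differentiableAt
  · filter_upwards [hmem] with x hx using (hcont x hx).aestronglyMeasurable
  · exact (hcont w (mem_ball_self (half_pos hδ))).intervalIntegrable _ _
  · exact (hd.smul (hu'.div ((hv'.sub continuous_const).pow 2) fun θ ↦
      pow_ne_zero 2 (hne w (mem_ball_self (half_pos hδ)) θ))).aestronglyMeasurable
  · refine Eventually.of_forall fun θ _ x hx ↦ ?_
    rw [norm_smul, norm_div, norm_pow]
    gcongr
    exact hlow x hx θ
  · exact (hd.norm.mul (hu'.norm.div_const _)).intervalIntegrable _ _
  · refine Eventually.of_forall fun θ _ x hx ↦ ?_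
    have h1 : HasDerivAt (fun x ↦ v (circleMap 0 R θ) - x) (-1) x := by
      simpa using (hasDerivAt_id x).const_sub (v (circleMap 0 R θ))
    exact (((hasDerivAt_const x (u (circleMap 0 R θ))).div h1 (hne x hx θ)).const_smul
      (deriv (circleMap 0 R) θ)).congr_deriv (by simp)

/-- Cauchy-type integrals vanish at infinity. -/
lemma tendsto_circleIntegral_div_sub_cocompact {u v : ℂ → ℂ} {R : ℝ} (hR : 0 ≤ R)
    (hu : ContinuousOn u (sphere 0 R)) (hv : ContinuousOn v (sphere 0 R)) :
    Tendsto (fun w ↦ ∮ ζ in C(0, R), u ζ / (v ζ - w)) (cocompact ℂ) (nhds 0) := by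
  obtain ⟨A, hA⟩ := (isCompact_sphere (0 : ℂ) R).exists_bound_of_continuousOn hu
  obtain ⟨B, hB⟩ := (isCompact_sphere (0 : ℂ) R).exists_bound_of_continuousOn hv
  have hnorm : Tendsto (fun w : ℂ ↦ ‖w‖ - B) (cocompact ℂ) atTop :=
    tendsto_atTop_add_const_right _ (-B) (tendsto_norm_cocompact_atTop (E := ℂ))
  have hlim : Tendsto (fun w : ℂ ↦ 2 * Real.pi * R * (|A| / (‖w‖ - B))) (cocompact ℂ) (nhds 0) := by
    simpa using (hnorm.const_div_atTop |A|).const_mul (2 * Real.pi * R)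
  refine squeeze_zero_norm' ?_ hlim
  filter_upwards [hnorm.eventually_gt_atTop 0] with w hw
  refine circleIntegral.norm_integral_le_of_norm_le_const hR fun ζ hζ ↦ ?_
  rw [norm_div]
  have h1 : ‖w‖ - B ≤ ‖v ζ - w‖ := by
    rw [norm_sub_rev]
    linarith [norm_sub_norm_le w (v ζ), hB ζ hζ]
  gcongr
  exact (hA ζ hζ).trans (le_abs_self A)

/-- The Cauchy integral formula on an annulus around the origin. -/
lemma circleIntegral_div_sub_annulus {h : ℂ → ℂ} {r R : ℝ} (hr : 0 < r) (hrR : r ≤ R)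
    (hc : ContinuousOn h (closedBall 0 R \ ball 0 r))
    (hd : ∀ z ∈ ball 0 R \ closedBall 0 r, DifferentiableAt ℂ h z) {a : ℂ}
    (ha : a ∈ ball (0 : ℂ) R \ closedBall 0 r) :
    (∮ ζ in C(0, R), h ζ / (ζ - a)) =
      (∮ ζ in C(0, r), h ζ / (ζ - a)) + 2 * Real.pi * Complex.I * h a := by
  have haR : ‖a‖ < R := by simpa using ha.1
  have har : r < ‖a‖ := by simpa using ha.2
  have hopen : IsOpen (ball (0 : ℂ) R \ closedBall 0 r) := isOpen_ball.sdiff isClosed_closedBall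
  have hnhds : closedBall (0 : ℂ) R \ ball 0 r ∈ nhds a :=
    mem_of_superset (hopen.mem_nhds ha)
      (Set.sdiff_subset_sdiff ball_subset_closedBall ball_subset_closedBall)
  have hcs : ContinuousOn (dslope h a) (closedBall 0 R \ ball 0 r) :=
    (continuousOn_dslope hnhds).2 ⟨hc, hd a ha⟩
  have heq := Complex.circleIntegral_eq_of_differentiable_on_annulus_off_countable hr hrR
    (Set.countable_singleton a) hcs fun z hz ↦
      (differentiableAt_dslope_of_ne hz.2).2 (hd z hz.1)
  have hsub : ∀ ρ : ℝ, r ≤ ρ → ρ ≤ R → sphere (0 : ℂ) ρ ⊆ closedBall 0 R \ ball 0 r := by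
    intro ρ h1 h2 z hz
    have : ‖z‖ = ρ := by simpa using hz
    simp [this, h1, h2]
  have hsplit : ∀ ρ : ℝ, r ≤ ρ → ρ ≤ R → ‖a‖ ≠ ρ → (∮ ζ in C(0, ρ), h ζ / (ζ - a)) =
      (∮ ζ in C(0, ρ), dslope h a ζ) + h a * ∮ ζ in C(0, ρ), (ζ - a)⁻¹ := by
    intro ρ h1 h2 h3
    have hρ : 0 ≤ ρ := hr.le.trans h1
    have hne : ∀ z ∈ sphere (0 : ℂ) ρ, z ≠ a := by
      rintro z hz rfl
      exact h3 (by simpa using hz)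
    rw [← circleIntegral.integral_const_mul, ← circleIntegral.integral_add
      ((hcs.mono (hsub ρ h1 h2)).circleIntegrable hρ)]
    · refine circleIntegral.integral_congr hρ fun z hz ↦ ?_
      have : z - a ≠ 0 := sub_ne_zero.2 (hne z hz)
      simp only [dslope_of_ne _ (hne z hz), slope_def_field]
      field_simp
      ring
    · refine ContinuousOn.circleIntegrable hρ ?_
      exact continuousOn_const.mul ((continuousOn_id.sub continuousOn_const).inv₀
        fun z hz ↦ sub_ne_zero.2 (hne z hz))
  have hzero : (∮ ζ in C(0, r), (ζ - a)⁻¹) = 0 := by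
    refine Complex.circleIntegral_eq_zero_of_differentiable_on_off_countable hr.le
      Set.countable_empty (s := ∅) (fun z hz ↦ ?_) fun z hz ↦ ?_
    · refine ((continuousAt_id.sub continuousAt_const).inv₀ (sub_ne_zero.2 ?_)).continuousWithinAt
      rintro rfl
      exact ha.2 hz
    · refine (differentiableAt_id.sub_const a).inv (sub_ne_zero.2 ?_)
      rintro rfl
      exact ha.2 (ball_subset_closedBall hz.1)
  rw [hsplit R hrR le_rfl haR.ne, hsplit r le_rfl hrR har.ne', heq, hzero,
    circleIntegral.integral_sub_inv_of_mem_ball ha.1]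
  ring

/-- An injective holomorphic function maps balls to open sets. -/
lemma isOpen_image_ball_of_injOn {φ : ℂ → ℂ} {V : Set ℂ} (hV : IsOpen V)
    (hd : DifferentiableOn ℂ φ V) (hinj : Set.InjOn φ V) {c : ℂ} {r : ℝ} (hr : 0 < r)
    (hs : ball c r ⊆ V) : IsOpen (φ '' ball c r) := by
  have han : AnalyticOnNhd ℂ φ (ball c r) := (hd.analyticOnNhd hV).mono hs
  rcases han.is_constant_or_isOpen (convex_ball c r).isPreconnected with ⟨w, hw⟩ | h
  · have h1 : c ∈ ball c r := mem_ball_self hr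
    have h2 : c + (r / 2 : ℝ) ∈ ball c r := by
      rw [mem_ball, dist_eq_norm, add_sub_cancel_left, Complex.norm_real, Real.norm_eq_abs,
        abs_of_pos (half_pos hr)]
      exact half_lt_self hr
    have h3 := hinj (hs h1) (hs h2) ((hw _ h1).trans (hw _ h2).symm)
    have h4 : ((r / 2 : ℝ) : ℂ) = 0 := by simpa using h3
    exact absurd (Complex.ofReal_eq_zero.1 h4) (half_pos hr).ne'
  · exact h _ subset_rfl isOpen_ball

lemma closure_image_ball_subset {φ : ℂ → ℂ} (hc : ContinuousOn φ (closedBall 0 1)) :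
    closure (φ '' ball (0 : ℂ) 1) ⊆ φ '' closedBall 0 1 :=
  closure_minimal (Set.image_mono ball_subset_closedBall)
    ((isCompact_closedBall 0 1).image_of_continuousOn hc).isClosed

/-- If `g` is holomorphic outside the closure of the univalent image of the unit disk, continuous up
to the boundary and vanishes at infinity, then its Cauchy integral over the boundary vanishes at
every interior point. -/
lemma circleIntegral_comp_mul_deriv_div_sub_eq_zero {φ g : ℂ → ℂ} {V : Set ℂ} (hV : IsOpen V)
    (hVball : closedBall (0 : ℂ) 1 ⊆ V) (hd : DifferentiableOn ℂ φ V) (hinj : Set.InjOn φ V)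
    (hcrit : {z ∈ V | deriv φ z = 0}.Finite)
    (hgc : ContinuousOn g (φ '' ball 0 1)ᶜ)
    (hgd : ∀ z ∈ (closure (φ '' ball (0 : ℂ) 1))ᶜ, DifferentiableAt ℂ g z)
    (hg0 : Tendsto g (cocompact ℂ) (nhds 0)) {a : ℂ} (ha : a ∈ ball (0 : ℂ) 1) :
    (∮ ζ in C(0, 1), g (φ ζ) * deriv φ ζ / (φ ζ - φ a)) = 0 := by
  obtain ⟨R, hR1, hRV, hRd⟩ : ∃ R : ℝ, 1 < R ∧ closedBall (0 : ℂ) R ⊆ V ∧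
      ∀ z ∈ closedBall (0 : ℂ) R, z ∉ closedBall (0 : ℂ) 1 → deriv φ z ≠ 0 := by
    have hopen : IsOpen (V \ ({z ∈ V | deriv φ z = 0} \ closedBall 0 1)) :=
      hV.sdiff (hcrit.subset Set.sdiff_subset).isClosed
    obtain ⟨δ, hδ, hsub⟩ := (isCompact_closedBall (0 : ℂ) 1).exists_cthickening_subset_open hopen
      fun z hz ↦ ⟨hVball hz, fun h ↦ h.2 hz⟩
    rw [cthickening_closedBall hδ.le zero_le_one] at hsub
    exact ⟨δ + 1, by linarith, fun z hz ↦ (hsub hz).1,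
      fun z hz hz1 h ↦ (hsub hz).2 ⟨⟨(hsub hz).1, h⟩, hz1⟩⟩
  have hR0 : 0 < R := by linarith
  have hdat : ∀ z ∈ V, DifferentiableAt ℂ φ z := fun z hz ↦ hd.differentiableAt (hV.mem_nhds hz)
  have hd' : DifferentiableOn ℂ (deriv φ) V := hd.deriv hV
  have hclos := closure_image_ball_subset (hd.continuousOn.mono hVball)
  have hRball : ball (0 : ℂ) R ⊆ V := ball_subset_closedBall.trans hRV
  have hball1 : ball (0 : ℂ) 1 ⊆ V := ball_subset_closedBall.trans hVball
  have hopen : IsOpen (φ '' ball 0 R) := isOpen_image_ball_of_injOn hV hd hinj hR0 hRball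
  have hout : ∀ z ∈ V, z ∉ ball (0 : ℂ) 1 → φ z ∈ (φ '' ball (0 : ℂ) 1)ᶜ := by
    rintro z hz hz1 ⟨y, hy, hyz⟩
    exact hz1 (hinj (hball1 hy) hz hyz ▸ hy)
  have hout' : ∀ z ∈ V, z ∉ closedBall (0 : ℂ) 1 → φ z ∈ (closure (φ '' ball (0 : ℂ) 1))ᶜ := by
    intro z hz hz1 h
    obtain ⟨y, hy, hyz⟩ := hclos h
    exact hz1 (hinj (hVball hy) hz hyz ▸ hy)
  set u : ℂ → ℂ := fun ζ ↦ g (φ ζ) * deriv φ ζ with hu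
  have hgφ : ContinuousOn (fun ζ ↦ g (φ ζ)) (closedBall 0 R \ ball 0 1) :=
    hgc.comp (hd.continuousOn.mono (Set.sdiff_subset.trans hRV)) fun z hz ↦ hout z (hRV hz.1) hz.2
  have huc : ContinuousOn u (closedBall 0 R \ ball 0 1) :=
    hgφ.mul (hd'.continuousOn.mono (Set.sdiff_subset.trans hRV))
  have hud : ∀ z ∈ ball 0 R \ closedBall 0 1, DifferentiableAt ℂ u z := fun z hz ↦
    ((hgd _ (hout' z (hRball hz.1) hz.2)).comp z (hdat z (hRball hz.1))).mul
      (hd'.differentiableAt (hV.mem_nhds (hRball hz.1)))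
  have hsub : ∀ ρ : ℝ, 1 ≤ ρ → ρ ≤ R → sphere (0 : ℂ) ρ ⊆ closedBall 0 R \ ball 0 1 := by
    intro ρ h1 h2 z hz
    have : ‖z‖ = ρ := by simpa using hz
    simp [this, h1, h2]
  set A : ℝ → ℂ → ℂ := fun ρ w ↦ ∮ ζ in C(0, ρ), u ζ / (φ ζ - w)
  have hAd : ∀ ρ : ℝ, 1 ≤ ρ → ρ ≤ R → ∀ w ∉ φ '' sphere 0 ρ, DifferentiableAt ℂ (A ρ) w :=
    fun ρ h1 h2 w hw ↦ differentiableAt_circleIntegral_div_sub (zero_le_one.trans h1)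
      (huc.mono (hsub ρ h1 h2))
      (hd.continuousOn.mono ((hsub ρ h1 h2).trans (Set.sdiff_subset.trans hRV))) hw
  have hinner : ∀ b ∈ ball (0 : ℂ) 1, A R (φ b) = A 1 (φ b) := by
    intro b hb
    have hne : ∀ z ∈ V, z ∉ ball (0 : ℂ) 1 → φ z - φ b ≠ 0 := fun z hz hz1 h ↦
      hz1 (hinj hz (hball1 hb) (sub_eq_zero.1 h) ▸ hb)
    refine Complex.circleIntegral_eq_of_differentiable_on_annulus_off_countable zero_lt_one hR1.le
      Set.countable_empty
      (huc.div ((hd.continuousOn.mono (Set.sdiff_subset.trans hRV)).sub continuousOn_const)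
        fun z hz ↦ hne z (hRV hz.1) hz.2) fun z hz ↦ ?_
    exact (hud z hz.1).div ((hdat z (hRball hz.1.1)).sub_const _)
      (hne z (hRball hz.1.1) fun h ↦ hz.1.2 (ball_subset_closedBall h))
  have hannulus : ∀ b ∈ ball (0 : ℂ) R \ closedBall 0 1,
      A R (φ b) = A 1 (φ b) + 2 * Real.pi * Complex.I * g (φ b) := by
    intro b hb
    have hbV := hRball hb.1
    have hdb : deriv φ b ≠ 0 := hRd b (ball_subset_closedBall hb.1) hb.2
    have hne : ∀ z ∈ V, dslope φ b z ≠ 0 := by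
      intro z hz
      rcases eq_or_ne z b with rfl | hzb
      · rwa [dslope_same]
      · rw [dslope_of_ne _ hzb, slope_def_field]
        exact div_ne_zero (sub_ne_zero.2 fun h ↦ hzb (hinj hz hbV h)) (sub_ne_zero.2 hzb)
    have hds : DifferentiableOn ℂ (dslope φ b) V :=
      (Complex.differentiableOn_dslope (hV.mem_nhds hbV)).2 hd
    have key := circleIntegral_div_sub_annulus (h := fun ζ ↦ u ζ / dslope φ b ζ) zero_lt_one hR1.le
      (huc.div (hds.continuousOn.mono (Set.sdiff_subset.trans hRV)) fun z hz ↦ hne z (hRV hz.1))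
      (fun z hz ↦ (hud z hz).div (hds.differentiableAt (hV.mem_nhds (hRball hz.1)))
        (hne z (hRball hz.1))) hb
    have hcongr : ∀ ρ : ℝ, 0 ≤ ρ →
        A ρ (φ b) = ∮ ζ in C(0, ρ), u ζ / dslope φ b ζ / (ζ - b) := by
      intro ρ hρ
      refine circleIntegral.integral_congr hρ fun z _ ↦ ?_
      rw [← sub_smul_dslope φ b z, smul_eq_mul, mul_comm, div_div]
    rw [hcongr R hR0.le, hcongr 1 zero_le_one, key, hu]
    simp only [dslope_same]
    rw [mul_div_cancel_right₀ _ hdb]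
  classical
  set k : ℂ → ℂ := fun w ↦
    if w ∈ φ '' ball 0 R then A R w else A 1 w + 2 * Real.pi * Complex.I * g w with hk
  have hkout : ∀ w ∈ (closure (φ '' ball (0 : ℂ) 1))ᶜ, w ∉ φ '' sphere 0 1 →
      k w = A 1 w + 2 * Real.pi * Complex.I * g w := by
    intro w hw hw1
    by_cases h : w ∈ φ '' ball 0 R
    · rw [hk]
      simp only [if_pos h]
      obtain ⟨b, hb, rfl⟩ := h
      refine hannulus b ⟨hb, fun hb1 ↦ ?_⟩
      rcases (ball_union_sphere (x := (0 : ℂ)) (ε := 1)).symm ▸ hb1 with h | h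
      · exact hw (subset_closure ⟨b, h, rfl⟩)
      · exact hw1 ⟨b, h, rfl⟩
    · simp only [hk, if_neg h]
  have hkd : Differentiable ℂ k := by
    intro w
    by_cases h : w ∈ φ '' ball 0 R
    · have hev : k =ᶠ[nhds w] A R := by
        filter_upwards [hopen.mem_nhds h] with x hx
        simp only [hk, if_pos hx]
      refine (hAd R hR1.le le_rfl w ?_).congr_of_eventuallyEq hev
      rintro ⟨y, hy, hyw⟩
      obtain ⟨b, hb, rfl⟩ := h
      have := hinj (hRV (sphere_subset_closedBall hy)) (hRball hb) hyw
      subst this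
      exact (mem_ball.1 hb).ne (mem_sphere.1 hy)
    · have hw : w ∈ (φ '' closedBall 0 1)ᶜ := by
        rintro ⟨y, hy, rfl⟩
        exact h ⟨y, closedBall_subset_ball hR1 hy, rfl⟩
      have hop : IsOpen (φ '' closedBall (0 : ℂ) 1)ᶜ :=
        ((isCompact_closedBall 0 1).image_of_continuousOn
          (hd.continuousOn.mono hVball)).isClosed.isOpen_compl
      have hev : k =ᶠ[nhds w] fun w ↦ A 1 w + 2 * Real.pi * Complex.I * g w := by
        filter_upwards [hop.mem_nhds hw] with x hx
        exact hkout x (fun h ↦ hx (hclos h)) fun h ↦ hx (Set.image_mono sphere_subset_closedBall h)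
      exact ((hAd 1 le_rfl hR1.le w fun h ↦ hw (Set.image_mono sphere_subset_closedBall h)).add
        ((hgd w fun h ↦ hw (hclos h)).const_mul _)).congr_of_eventuallyEq hev
  have hk0 : Tendsto k (cocompact ℂ) (nhds 0) := by
    have h1 : Tendsto (fun w ↦ A 1 w + 2 * Real.pi * Complex.I * g w) (cocompact ℂ) (nhds 0) := by
      simpa using (tendsto_circleIntegral_div_sub_cocompact zero_le_one
        (huc.mono (hsub 1 le_rfl hR1.le)) (hd.continuousOn.mono
          (sphere_subset_closedBall.trans hVball))).add (hg0.const_mul (2 * Real.pi * Complex.I))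
    refine h1.congr' ?_
    filter_upwards [((isCompact_closedBall (0 : ℂ) 1).image_of_continuousOn
      (hd.continuousOn.mono hVball)).compl_mem_cocompact] with x hx
    exact (hkout x (fun h ↦ hx (hclos h))
      fun h ↦ hx (Set.image_mono sphere_subset_closedBall h)).symm
  have hzero := hkd.apply_eq_of_tendsto_cocompact (φ a) hk0
  rw [hk] at hzero
  simp only [if_pos (Set.mem_image_of_mem φ (ball_subset_ball hR1.le ha))] at hzero
  exact (hinner a ha).symm.trans hzero

open ComplexConjugate in
lemma conj_circleIntegral_unit (u : ℂ → ℂ) :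
    conj (∮ ζ in C(0, 1), u ζ) = -∮ ζ in C(0, 1), conj (u ζ) * (ζ ^ 2)⁻¹ := by
  simp only [circleIntegral, smul_eq_mul]
  rw [intervalIntegral.integral_of_le Real.two_pi_pos.le,
    intervalIntegral.integral_of_le Real.two_pi_pos.le, ← integral_conj,
    ← MeasureTheory.integral_neg]
  congr 1
  ext θ
  have hne : circleMap 0 1 θ ≠ 0 := circleMap_ne_center one_ne_zero
  have hconj : conj (circleMap 0 1 θ) = (circleMap 0 1 θ)⁻¹ := by
    rw [Complex.inv_eq_conj (by simp)]
  simp only [deriv_circleMap, map_mul, hconj, Complex.conj_I]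
  field_simp

open ComplexConjugate in
/-- The integral of the conjugate of a holomorphic function against a simple pole off the unit
circle. -/
lemma circleIntegral_conj_div_sub {G : ℂ → ℂ} (hG : DiffContOnCl ℂ G (ball 0 1)) {ρ : ℂ}
    (hρ : ‖ρ‖ ≠ 1) :
    (∮ ζ in C(0, 1), conj (G ζ) / (ζ - ρ)) =
      2 * Real.pi * Complex.I * conj (G 0 - if 1 < ‖ρ‖ then G (conj ρ)⁻¹ else 0) := by
  have hne : ∀ ζ ∈ sphere (0 : ℂ) 1, ζ ≠ 0 ∧ 1 - conj ρ * ζ ≠ 0 := by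
    intro ζ hζ
    have hn : ‖ζ‖ = 1 := by simpa using hζ
    refine ⟨norm_ne_zero_iff.1 (by simp [hn]), fun h ↦ hρ ?_⟩
    have := congrArg norm (sub_eq_zero.1 h)
    simpa [hn] using this.symm
  have hstep : conj (∮ ζ in C(0, 1), conj (G ζ) / (ζ - ρ)) =
      -∮ ζ in C(0, 1), (ζ - 0)⁻¹ • (G ζ / (1 - conj ρ * ζ)) := by
    rw [conj_circleIntegral_unit]
    congr 1
    refine circleIntegral.integral_congr zero_le_one fun ζ hζ ↦ ?_
    obtain ⟨h0, h1⟩ := hne ζ hζ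
    have hconj : conj ζ = ζ⁻¹ := (Complex.inv_eq_conj (by simpa using hζ)).symm
    have h2 : ζ⁻¹ - conj ρ ≠ 0 := by
      intro h
      apply h1
      rw [← sub_eq_zero.1 h, inv_mul_cancel₀ h0, sub_self]
    simp only [map_div₀, map_sub, Complex.conj_conj, hconj, sub_zero, smul_eq_mul]
    field_simp
  have hzero : (0 : ℂ) ∈ ball (0 : ℂ) 1 := mem_ball_self one_pos
  apply (starRingEnd ℂ).injective
  rw [hstep]
  simp only [map_mul, Complex.conj_conj, Complex.conj_I, Complex.conj_ofReal, map_ofNat]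
  split_ifs with h
  · have hρ0 : conj ρ ≠ 0 := by
      rw [Ne, map_eq_zero]
      rintro rfl
      norm_num at h
    have hb : (conj ρ)⁻¹ ∈ ball (0 : ℂ) 1 := by
      simpa using inv_lt_one_of_one_lt₀ h
    have hsplit : (∮ ζ in C(0, 1), (ζ - 0)⁻¹ • (G ζ / (1 - conj ρ * ζ))) =
        (∮ ζ in C(0, 1), (ζ - 0)⁻¹ • G ζ) - ∮ ζ in C(0, 1), (ζ - (conj ρ)⁻¹)⁻¹ • G ζ := by
      have hc : ContinuousOn G (sphere 0 1) :=
        hG.continuousOn_ball.mono sphere_subset_closedBall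
      have hnb : ∀ ζ ∈ sphere (0 : ℂ) 1, ζ - (conj ρ)⁻¹ ≠ 0 := fun ζ hζ h ↦ by
        rw [← sub_eq_zero.1 h] at hb
        exact (mem_ball.1 hb).ne hζ
      rw [← circleIntegral.integral_sub]
      · refine circleIntegral.integral_congr zero_le_one fun ζ hζ ↦ ?_
        obtain ⟨h0, h1⟩ := hne ζ hζ
        have h2 := hnb ζ hζ
        have h3 : ζ - (conj ρ)⁻¹ = -(1 - conj ρ * ζ) / conj ρ := by
          field_simp
          ring
        simp only [sub_zero, smul_eq_mul]
        rw [h3, inv_div]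
        generalize he : 1 - conj ρ * ζ = e at h1 ⊢
        have h4 : conj ρ = (1 - e) / ζ := by
          rw [← he]
          field_simp
          ring
        rw [h4]
        field_simp
        ring
      · exact ContinuousOn.circleIntegrable zero_le_one
          (((continuousOn_id.sub continuousOn_const).inv₀
            fun ζ hζ ↦ by simpa using (hne ζ hζ).1).smul hc)
      · exact ContinuousOn.circleIntegrable zero_le_one
          (((continuousOn_id.sub continuousOn_const).inv₀ hnb).smul hc)
    rw [hsplit, hG.circleIntegral_sub_inv_smul hzero, hG.circleIntegral_sub_inv_smul hb]
    simp only [smul_eq_mul]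
    ring
  · have hlt : ‖ρ‖ < 1 := lt_of_le_of_ne (not_lt.1 h) hρ
    have hH : DiffContOnCl ℂ (fun ζ ↦ G ζ / (1 - conj ρ * ζ)) (ball 0 1) := by
      have hden : ∀ ζ ∈ closedBall (0 : ℂ) 1, 1 - conj ρ * ζ ≠ 0 := by
        intro ζ hζ h
        have hn : ‖ζ‖ ≤ 1 := by simpa using hζ
        have h1 := congrArg norm (sub_eq_zero.1 h)
        rw [norm_one, norm_mul, RCLike.norm_conj] at h1
        nlinarith [norm_nonneg ρ, norm_nonneg ζ]
      refine ⟨hG.differentiableOn.div (by fun_prop) fun ζ hζ ↦ hden ζ (ball_subset_closedBall hζ),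
        hG.continuousOn.div (by fun_prop) fun ζ hζ ↦ hden ζ (closure_ball_subset_closedBall hζ)⟩
    rw [hH.circleIntegral_sub_inv_smul hzero]
    simp

open ComplexConjugate in
/-- The integral of the conjugate of a holomorphic function against the logarithmic derivative of a
polynomial without roots on the unit circle. -/
lemma circleIntegral_conj_mul_logDeriv {G : ℂ → ℂ} (hG : DiffContOnCl ℂ G (ball 0 1)) {P : ℂ[X]}
    (hP : ∀ ζ ∈ sphere (0 : ℂ) 1, P.eval ζ ≠ 0) :
    (∮ ζ in C(0, 1), conj (G ζ) * (P.derivative.eval ζ / P.eval ζ)) =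
      (P.roots.map fun ρ ↦ 2 * Real.pi * Complex.I *
        conj (G 0 - if 1 < ‖ρ‖ then G (conj ρ)⁻¹ else 0)).sum := by
  have hc : ContinuousOn (fun ζ ↦ conj (G ζ)) (sphere 0 1) :=
    Complex.continuous_conj.comp_continuousOn (hG.continuousOn_ball.mono sphere_subset_closedBall)
  have hsum : ∀ s : Multiset ℂ, (∀ ρ ∈ s, ‖ρ‖ ≠ 1) →
      ContinuousOn (fun ζ ↦ conj (G ζ) * (s.map fun ρ ↦ 1 / (ζ - ρ)).sum) (sphere 0 1) ∧
      (∮ ζ in C(0, 1), conj (G ζ) * (s.map fun ρ ↦ 1 / (ζ - ρ)).sum) =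
      (s.map fun ρ ↦ 2 * Real.pi * Complex.I *
        conj (G 0 - if 1 < ‖ρ‖ then G (conj ρ)⁻¹ else 0)).sum := by
    intro s
    induction s using Multiset.induction_on with
    | empty => intro _; simp [circleIntegral, continuousOn_const]
    | cons ρ s ih =>
      intro hs
      obtain ⟨hcs, his⟩ := ih fun x hx ↦ hs x (Multiset.mem_cons_of_mem hx)
      have hρ := hs ρ (Multiset.mem_cons_self ρ s)
      have hcρ : ContinuousOn (fun ζ ↦ conj (G ζ) / (ζ - ρ)) (sphere 0 1) := by
        refine hc.div (by fun_prop) fun ζ hζ h ↦ hρ ?_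
        rw [← sub_eq_zero.1 h]
        simpa using hζ
      simp only [Multiset.map_cons, Multiset.sum_cons, mul_add, mul_one_div]
      refine ⟨hcρ.add hcs, ?_⟩
      rw [circleIntegral.integral_add (hcρ.circleIntegrable zero_le_one)
        (hcs.circleIntegrable zero_le_one), his, circleIntegral_conj_div_sub hG hρ]
  rw [← (hsum P.roots fun ρ hρ h ↦ hP ρ (by simpa using h) (Polynomial.isRoot_of_mem_roots hρ)).2]
  refine circleIntegral.integral_congr zero_le_one fun ζ hζ ↦ ?_
  rw [(IsAlgClosed.splits P).eval_derivative_div_eval_of_ne_zero (hP ζ hζ)]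

lemma Multiset.sum_map_ite_eq_countP_nsmul {α M : Type*} [AddCommMonoid M] (s : Multiset α)
    (P : α → Prop) [DecidablePred P] (c : M) :
    (s.map fun x ↦ if P x then c else 0).sum = s.countP P • c := by
  induction s using Multiset.induction_on with
  | empty => simp
  | cons x s ih =>
    by_cases h : P x <;> simp [h, ih, add_smul, add_comm]

/-- The derivative of a quotient of coprime polynomials, in terms of the Wronskian. -/
lemma hasDerivAt_eval_div_eval (p q : ℂ[X]) {z : ℂ} (hz : q.eval z ≠ 0) :
    HasDerivAt (fun z ↦ p.eval z / q.eval z) (-(wronskian p q).eval z / q.eval z ^ 2) z := by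
  refine ((p.hasDerivAt z).div (q.hasDerivAt z) hz).congr_deriv ?_
  simp [wronskian]

lemma wronskian_ne_zero_of_isCoprime {p q : ℂ[X]} (hcop : IsCoprime p q)
    (hdeg : 2 ≤ max p.natDegree q.natDegree) : wronskian p q ≠ 0 := by
  intro h
  obtain ⟨hp, hq⟩ := hcop.wronskian_eq_zero_iff.1 h
  rw [derivative_eq_zero] at hp hq
  omega

open ComplexConjugate in
/-- For a matching pair on the univalent image of the disk under `p / q`, the values of the
interior function at the reflections of the exterior preimages of an interior point lie in a fixed
finite set. -/
lemma IsMatchingPair.apply_reflection_mem {p q : ℂ[X]} (hw : wronskian p q ≠ 0)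
    {U : Set ℂ} (hU : IsOpen U) (hUball : closedBall (0 : ℂ) 1 ⊆ U) (hq : ∀ z ∈ U, q.eval z ≠ 0)
    {φ : ℂ → ℂ} (hφ : ∀ z, φ z = p.eval z / q.eval z) (hinj : Set.InjOn φ U)
    {f g : ℂ → ℂ} (hfg : IsMatchingPair (φ '' ball 0 1) f g) {a ρ : ℂ}
    (ha : a ∈ ball (0 : ℂ) 1) (hρ : 1 < ‖ρ‖) (hroot : p.eval ρ = φ a * q.eval ρ)
    (hne : p - C (φ a) * q ≠ 0) :
    f (φ (conj ρ)⁻¹) ∈ insert 0 (insert (f (φ 0))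
      (q.roots.toFinset.image fun σ ↦ f (φ (conj σ)⁻¹))) := by
  classical
  obtain ⟨hfc, hfd, hgc, hgd, hg0, hfg⟩ := hfg
  have hφ' : φ = fun z ↦ p.eval z / q.eval z := funext hφ
  have hderiv : ∀ z ∈ U, HasDerivAt φ (-(wronskian p q).eval z / q.eval z ^ 2) z := by
    intro z hz
    rw [hφ']
    exact hasDerivAt_eval_div_eval p q (hq z hz)
  have hd : DifferentiableOn ℂ φ U := fun z hz ↦
    (hderiv z hz).differentiableAt.differentiableWithinAt
  have hball1 : ball (0 : ℂ) 1 ⊆ U := ball_subset_closedBall.trans hUball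
  have hcrit : {z ∈ U | deriv φ z = 0}.Finite := by
    refine (finite_setOfPred_isRoot hw).subset fun z hz ↦ ?_
    have := hz.2
    rw [(hderiv z hz.1).deriv, div_eq_zero_iff] at this
    simpa [hq z hz.1] using this
  have hopen : IsOpen (φ '' ball 0 1) := isOpen_image_ball_of_injOn hU hd hinj one_pos hball1
  have hmapsTo : Set.MapsTo φ (closedBall 0 1) (closure (φ '' ball (0 : ℂ) 1)) := by
    rw [← closure_ball (0 : ℂ) one_ne_zero]
    refine (Set.mapsTo_image φ _).closure_of_continuousOn ?_
    rw [closure_ball (0 : ℂ) one_ne_zero]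
    exact hd.continuousOn.mono hUball
  have hfront : ∀ ζ ∈ sphere (0 : ℂ) 1, φ ζ ∈ frontier (φ '' ball 0 1) := by
    intro ζ hζ
    rw [hopen.frontier_eq]
    refine ⟨hmapsTo (sphere_subset_closedBall hζ), ?_⟩
    rintro ⟨y, hy, hyz⟩
    have := hinj (hball1 hy) (hUball (sphere_subset_closedBall hζ)) hyz
    subst this
    exact (mem_ball.1 hy).ne (mem_sphere.1 hζ)
  by_contra hmem
  set S : Finset ℂ := insert 0 (insert (f (φ 0))
      (q.roots.toFinset.image fun σ ↦ f (φ (conj σ)⁻¹))) with hS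
  set x := f (φ (conj ρ)⁻¹)
  set P : ℂ[X] := p - C (φ a) * q with hP
  set Q : ℂ[X] := ∏ y ∈ (S ∪ P.roots.toFinset.image fun σ ↦ f (φ (conj σ)⁻¹)).erase x,
    (X - C y) with hQ
  have hQx : Q.eval x ≠ 0 := by
    rw [hQ, eval_prod]
    refine Finset.prod_ne_zero_iff.2 fun y hy ↦ ?_
    rw [eval_sub, eval_X, eval_C]
    exact sub_ne_zero.2 (Finset.ne_of_mem_erase hy).symm
  have hQ0 : ∀ y ∈ S ∪ P.roots.toFinset.image (fun σ ↦ f (φ (conj σ)⁻¹)), y ≠ x →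
      Q.eval y = 0 := by
    intro y hy hyx
    rw [hQ, eval_prod]
    exact Finset.prod_eq_zero (Finset.mem_erase.2 ⟨hyx, hy⟩) (by simp)
  have hQS : ∀ y ∈ S, Q.eval y = 0 := fun y hy ↦
    hQ0 y (Finset.mem_union_left _ hy) fun h ↦ hmem (h ▸ hy)
  set G : ℂ → ℂ := fun ζ ↦ Q.eval (f (φ ζ)) with hGdef
  have hG : DiffContOnCl ℂ G (ball 0 1) := by
    refine ⟨fun ζ hζ ↦ ?_, ?_⟩
    · exact (Q.differentiableAt.comp ζ ((hfd _ ⟨ζ, hζ, rfl⟩).comp ζ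
        (hderiv ζ (hball1 hζ)).differentiableAt)).differentiableWithinAt
    · rw [closure_ball (0 : ℂ) one_ne_zero]
      exact Q.continuous.comp_continuousOn
        (hfc.comp (hd.continuousOn.mono hUball) hmapsTo)
  have hG0 : G 0 = 0 := hQS _ (by simp [hS])
  set Q' : ℂ[X] := Q.map (starRingEnd ℂ) with hQ'
  have hmapeval : ∀ z, Q'.eval (conj z) = conj (Q.eval z) := fun z ↦ by
    rw [hQ', eval_map, eval₂_at_apply]
  have hQ'0 : Q'.eval 0 = 0 := by
    simpa [hQS 0 (by simp [hS])] using hmapeval 0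
  have hint := circleIntegral_comp_mul_deriv_div_sub_eq_zero (g := fun z ↦ Q'.eval (g z)) hU hUball
    hd hinj hcrit (Q'.continuous.comp_continuousOn hgc)
    (fun z hz ↦ Q'.differentiableAt.comp z (hgd z hz))
    (by simpa [hQ'0, Function.comp_def] using (Q'.continuous.tendsto 0).comp hg0) ha
  have hPne : ∀ ζ ∈ sphere (0 : ℂ) 1, P.eval ζ ≠ 0 := by
    intro ζ hζ h
    have hζU := hUball (sphere_subset_closedBall hζ)
    have h1 : φ ζ = φ a := by
      rw [hφ ζ, div_eq_iff (hq ζ hζU)]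
      simpa [hP, sub_eq_zero] using h
    have := hinj hζU (hball1 ha) h1
    subst this
    exact (mem_ball.1 ha).ne (mem_sphere.1 hζ)
  have hqne : ∀ ζ ∈ sphere (0 : ℂ) 1, q.eval ζ ≠ 0 := fun ζ hζ ↦
    hq ζ (hUball (sphere_subset_closedBall hζ))
  have hGc : ContinuousOn (fun ζ ↦ conj (G ζ)) (sphere 0 1) :=
    Complex.continuous_conj.comp_continuousOn (hG.continuousOn_ball.mono sphere_subset_closedBall)
  have hci : ∀ r : ℂ[X], (∀ ζ ∈ sphere (0 : ℂ) 1, r.eval ζ ≠ 0) →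
      CircleIntegrable (fun ζ ↦ conj (G ζ) * (r.derivative.eval ζ / r.eval ζ)) 0 1 := fun r hr ↦
    (hGc.mul (r.derivative.continuousOn.div r.continuousOn hr)).circleIntegrable zero_le_one
  have hsplit : (∮ ζ in C(0, 1), Q'.eval (g (φ ζ)) * deriv φ ζ / (φ ζ - φ a)) =
      (∮ ζ in C(0, 1), conj (G ζ) * (P.derivative.eval ζ / P.eval ζ)) -
      ∮ ζ in C(0, 1), conj (G ζ) * (q.derivative.eval ζ / q.eval ζ) := by
    rw [← circleIntegral.integral_sub (hci P hPne) (hci q hqne)]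
    refine circleIntegral.integral_congr zero_le_one fun ζ hζ ↦ ?_
    have h1 : Q'.eval (g (φ ζ)) = conj (G ζ) := by
      rw [hGdef, ← hmapeval, hfg _ (hfront ζ hζ), Complex.conj_conj]
    have h2 := hPne ζ hζ
    have h3 := hqne ζ hζ
    have h4 : φ ζ - φ a = P.eval ζ / q.eval ζ := by
      rw [hφ ζ, hP]
      simp only [eval_sub, eval_mul, eval_C]
      field_simp
    rw [h1, h4, (hderiv ζ (hUball (sphere_subset_closedBall hζ))).deriv, mul_div_assoc,
      ← mul_sub]
    congr 1
    rw [div_sub_div _ _ h2 h3, div_div_div_eq, div_eq_div_iff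
      (mul_ne_zero (pow_ne_zero 2 h3) h2) (mul_ne_zero h2 h3)]
    simp only [hP, wronskian, derivative_sub, derivative_C_mul, eval_sub, eval_mul, eval_C]
    ring
  rw [hsplit, circleIntegral_conj_mul_logDeriv hG hPne,
    circleIntegral_conj_mul_logDeriv hG hqne, hG0] at hint
  have hqsum : (q.roots.map fun σ ↦ 2 * Real.pi * Complex.I *
      conj (0 - if 1 < ‖σ‖ then G (conj σ)⁻¹ else 0)).sum = 0 := by
    refine Multiset.sum_eq_zero fun y hy ↦ ?_
    obtain ⟨σ, hσ, rfl⟩ := Multiset.mem_map.1 hy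
    have : G (conj σ)⁻¹ = 0 := hQS _ (by
      rw [hS]
      exact Finset.mem_insert_of_mem (Finset.mem_insert_of_mem
        (Finset.mem_image_of_mem _ (Multiset.mem_toFinset.2 hσ))))
    simp [this]
  have hPsum : (P.roots.map fun σ ↦ 2 * Real.pi * Complex.I *
      conj (0 - if 1 < ‖σ‖ then G (conj σ)⁻¹ else 0)) =
      P.roots.map fun σ ↦ if 1 < ‖σ‖ ∧ f (φ (conj σ)⁻¹) = x then
        2 * Real.pi * Complex.I * conj (0 - Q.eval x) else 0 := by
    refine Multiset.map_congr rfl fun σ hσ ↦ ?_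
    by_cases h1 : 1 < ‖σ‖
    · by_cases h2 : f (φ (conj σ)⁻¹) = x
      · simp [h1, h2, hGdef]
      · have : Q.eval (f (φ (conj σ)⁻¹)) = 0 := hQ0 _ (Finset.mem_union_right _
          (Finset.mem_image_of_mem (fun σ ↦ f (φ (conj σ)⁻¹)) (Multiset.mem_toFinset.2 hσ))) h2
        simp [h1, h2, hGdef, this]
    · simp [h1]
  have hρmem : ρ ∈ P.roots := by
    rw [mem_roots hne, IsRoot.def, hP]
    simp [hroot]
  rw [hqsum, hPsum, sub_zero, Multiset.sum_map_ite_eq_countP_nsmul, nsmul_eq_mul, mul_eq_zero,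
    Nat.cast_eq_zero] at hint
  rcases hint with h | h
  · exact (Multiset.countP_pos_of_mem hρmem (p := fun σ ↦ 1 < ‖σ‖ ∧ f (φ (conj σ)⁻¹) = x)
      ⟨hρ, rfl⟩).ne' h
  · simp [hQx, Real.pi_ne_zero] at h

/-- A rational function of degree at least two which is univalent near the closed unit disk
takes some value in the image of the open disk at a point outside the closed disk. -/
lemma exists_exterior_preimage {p q : ℂ[X]} (hcop : IsCoprime p q)
    (hdeg : 2 ≤ max p.natDegree q.natDegree)
    {U : Set ℂ} (hUball : closedBall (0 : ℂ) 1 ⊆ U) (hq : ∀ z ∈ U, q.eval z ≠ 0)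
    {φ : ℂ → ℂ} (hφ : ∀ z, φ z = p.eval z / q.eval z) (hinj : Set.InjOn φ U) :
    ∃ a ∈ ball (0 : ℂ) 1, ∃ ρ : ℂ, 1 < ‖ρ‖ ∧ p.eval ρ = φ a * q.eval ρ := by
  have hball1 : ball (0 : ℂ) 1 ⊆ U := ball_subset_closedBall.trans hUball
  have hw := wronskian_ne_zero_of_isCoprime hcop hdeg
  have hcrit : {z | (wronskian p q).IsRoot z}.Finite := finite_setOfPred_isRoot hw
  have hlow : {a ∈ ball (0 : ℂ) 1 | (p - C (φ a) * q).natDegree < 2}.Subsingleton := by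
    rintro a ⟨ha, ha'⟩ b ⟨hb, hb'⟩
    by_contra hab
    have hne : φ a - φ b ≠ 0 := sub_ne_zero.2 fun h ↦ hab (hinj (hball1 ha) (hball1 hb) h)
    have hqdeg : q.natDegree < 2 := by
      have h1 : q = C (φ a - φ b)⁻¹ * ((p - C (φ b) * q) - (p - C (φ a) * q)) := by
        have h2 : (p - C (φ b) * q) - (p - C (φ a) * q) = C (φ a - φ b) * q := by
          rw [C_sub]
          ring
        rw [h2, ← mul_assoc, ← C_mul, inv_mul_cancel₀ hne, C_1, one_mul]
      rw [h1]
      refine (natDegree_C_mul_le _ _).trans_lt ((natDegree_sub_le _ _).trans_lt (max_lt hb' ha'))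
    have hpdeg : p.natDegree < 2 := by
      have h1 : p = (p - C (φ a) * q) + C (φ a) * q := by ring
      rw [h1]
      exact (natDegree_add_le _ _).trans_lt
        (max_lt ha' ((natDegree_C_mul_le _ _).trans_lt hqdeg))
    omega
  have hinf : (ball (0 : ℂ) 1).Infinite :=
    infinite_of_mem_nhds (0 : ℂ) (ball_mem_nhds 0 one_pos)
  obtain ⟨a, ⟨ha, hbad⟩⟩ := (hinf.sdiff (hcrit.union hlow.finite)).nonempty
  refine ⟨a, ha, ?_⟩
  have hwa : (wronskian p q).eval a ≠ 0 := fun h ↦ hbad (Or.inl h)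
  have hPdeg : 2 ≤ (p - C (φ a) * q).natDegree := not_lt.1 fun h ↦ hbad (Or.inr ⟨ha, h⟩)
  have hqa := hq a (hball1 ha)
  have hroota : p.eval a = φ a * q.eval a := by rw [hφ a, div_mul_cancel₀ _ hqa]
  set P : ℂ[X] := p - C (φ a) * q with hP
  have hPa : P.IsRoot a := by simp [hP, hroota]
  obtain ⟨T, hT⟩ := dvd_iff_isRoot.2 hPa
  have hTdeg : T.degree ≠ 0 := by
    intro h
    have hT0 : T ≠ 0 := fun h0 ↦ by simp [h0] at h
    rw [hT, natDegree_mul (X_sub_C_ne_zero a) hT0, natDegree_X_sub_C,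
      natDegree_eq_zero_iff_degree_le_zero.2 h.le] at hPdeg
    omega
  obtain ⟨ρ, hρ⟩ := IsAlgClosed.exists_root T hTdeg
  have hPρ : P.eval ρ = 0 := by rw [hT, eval_mul, hρ.eq_zero, mul_zero]
  have hρroot : p.eval ρ = φ a * q.eval ρ := by simpa [hP, sub_eq_zero] using hPρ
  refine ⟨ρ, ?_, hρroot⟩
  by_contra! hle
  have hρU : ρ ∈ U := hUball (by simpa using hle)
  have : ρ = a := hinj hρU (hball1 ha) (by rw [hφ ρ, div_eq_iff (hq ρ hρU), hρroot])
  subst this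
  have hder : P.derivative.eval ρ = 0 := by
    rw [hT, derivative_mul]
    simp [hρ.eq_zero]
  apply hwa
  simp only [hP, derivative_sub, derivative_C_mul, eval_sub, eval_mul, eval_C] at hder
  simp only [wronskian, eval_sub, eval_mul, hroota]
  linear_combination (-q.eval ρ) * hder

/-- Theorem 3.19: for an R-domain of degree ≥ 2 the matching problem has only the
trivial solution. -/
theorem rdomain_matching_trivial
    (p q : Polynomial ℂ) (hcop : IsCoprime p q)
    (hdeg : 2 ≤ max p.natDegree q.natDegree)
    (U : Set ℂ) (hU : IsOpen U) (hUball : closedBall (0 : ℂ) 1 ⊆ U)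
    (hq : ∀ z ∈ U, q.eval z ≠ 0)
    (φ : ℂ → ℂ) (hφ : ∀ z, φ z = p.eval z / q.eval z)
    (hinj : Set.InjOn φ U)
    (Ω : Set ℂ) (hΩ : Ω = φ '' ball (0 : ℂ) 1)
    (f g : ℂ → ℂ) (hfg : IsMatchingPair Ω f g) :
    ∃ k : ℂ, ∀ z ∈ Ω, f z = k := by
  subst hΩ
  have hball1 : ball (0 : ℂ) 1 ⊆ U := ball_subset_closedBall.trans hUball
  have hw := wronskian_ne_zero_of_isCoprime hcop hdeg
  have hφ' : φ = fun z ↦ p.eval z / q.eval z := funext hφ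
  have hdat : ∀ z, q.eval z ≠ 0 → DifferentiableAt ℂ φ z := by
    intro z hz
    rw [hφ']
    exact (hasDerivAt_eval_div_eval p q hz).differentiableAt
  have hd : DifferentiableOn ℂ φ U := fun z hz ↦ (hdat z (hq z hz)).differentiableWithinAt
  have hopen : IsOpen (φ '' ball 0 1) := isOpen_image_ball_of_injOn hU hd hinj one_pos hball1
  have hF : DifferentiableOn ℂ (fun ζ ↦ f (φ ζ)) (ball 0 1) := fun ζ hζ ↦
    ((hfg.2.1 _ ⟨ζ, hζ, rfl⟩).comp ζ (hdat ζ (hq ζ (hball1 hζ)))).differentiableWithinAt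
  obtain ⟨a, ha, ρ, hρ, hroot⟩ := exists_exterior_preimage hcop hdeg hUball hq hφ hinj
  have hqρ : q.eval ρ ≠ 0 := by
    intro h
    obtain ⟨s, t, hst⟩ := hcop
    have := congrArg (eval ρ) hst
    simp [hroot, h] at this
  have hφρ : φ ρ = φ a := by rw [hφ ρ, div_eq_iff hqρ, hroot]
  set S : Finset ℂ := insert 0 (insert (f (φ 0))
    (q.roots.toFinset.image fun σ ↦ f (φ ((starRingEnd ℂ) σ)⁻¹))) with hS
  have hρ0 : ρ ≠ 0 := by
    rintro rfl
    norm_num at hρ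
  set z₀ := ((starRingEnd ℂ) ρ)⁻¹ with hz₀
  have hz₀0 : z₀ ≠ 0 := by simpa [hz₀] using hρ0
  have hz₀ball : z₀ ∈ ball (0 : ℂ) 1 := by
    simpa [hz₀] using inv_lt_one_of_one_lt₀ hρ
  have hrefl : ContinuousAt (fun z : ℂ ↦ ((starRingEnd ℂ) z)⁻¹) z₀ :=
    Complex.continuous_conj.continuousAt.inv₀ (by simpa using hz₀0)
  have hreflz₀ : ((starRingEnd ℂ) z₀)⁻¹ = ρ := by simp [hz₀]
  have hVmem : ∀ᶠ ζ in nhds ρ, 1 < ‖ζ‖ ∧ q.eval ζ ≠ 0 ∧ φ ζ ∈ φ '' ball 0 1 := by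
    refine (continuous_norm.continuousAt.eventually_const_lt hρ).and
      ((q.continuous.continuousAt.eventually_ne hqρ).and ?_)
    exact (hdat ρ hqρ).continuousAt.eventually_mem (hopen.mem_nhds ⟨a, ha, hφρ.symm⟩)
  have hev : ∀ᶠ z in nhds z₀, f (φ z) ∈ S := by
    have h1 : ∀ᶠ z in nhds z₀, 1 < ‖((starRingEnd ℂ) z)⁻¹‖ ∧ q.eval ((starRingEnd ℂ) z)⁻¹ ≠ 0 ∧
        φ ((starRingEnd ℂ) z)⁻¹ ∈ φ '' ball 0 1 :=
      hrefl.eventually (hreflz₀.symm ▸ hVmem)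
    filter_upwards [h1] with z hz
    obtain ⟨hz1, hz2, b, hb, hbz⟩ := hz
    have hroot' : p.eval ((starRingEnd ℂ) z)⁻¹ = φ b * q.eval ((starRingEnd ℂ) z)⁻¹ := by
      rw [hbz, hφ, div_mul_cancel₀ _ hz2]
    have hne : p - C (φ b) * q ≠ 0 := by
      intro h
      have h2 : p = C (φ b) * q := sub_eq_zero.1 h
      apply hw
      rw [h2]
      simp only [wronskian, derivative_C_mul]
      ring
    have hmem := hfg.apply_reflection_mem hw hU hUball hq hφ hinj hb hz1 hroot' hne
    rwa [map_inv₀, Complex.conj_conj, inv_inv] at hmem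
  have hconst : (fun z ↦ f (φ z)) =ᶠ[nhds z₀] fun _ ↦ f (φ z₀) := by
    have hcont : ContinuousAt (fun z ↦ f (φ z)) z₀ :=
      (hF.differentiableAt (isOpen_ball.mem_nhds hz₀ball)).continuousAt
    have hcl : ((S.erase (f (φ z₀)) : Set ℂ))ᶜ ∈ nhds (f (φ z₀)) :=
      (S.erase (f (φ z₀))).finite_toSet.isClosed.isOpen_compl.mem_nhds (by simp)
    filter_upwards [hev, hcont.eventually_mem hcl] with z hz1 hz2
    by_contra hne
    exact hz2 (Finset.mem_coe.2 (Finset.mem_erase.2 ⟨hne, hz1⟩))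
  refine ⟨f (φ z₀), ?_⟩
  rintro _ ⟨z, hz, rfl⟩
  exact (hF.analyticOnNhd isOpen_ball).eqOn_of_preconnected_of_eventuallyEq analyticOnNhd_const
    (convex_ball 0 1).isPreconnected hz₀ball hconst hz
end

section
/- Let a, b > 0 with a ≠ b, and let Ω := {z ∈ ℂ : (Re z / a)^2 + (Im z / b)^2 < 1} be the open domain bounded by a non-circular ellipse. Then for every matching pair (f, g) for Ω, the function f is constant on Ω. -/
open Metric Filter

section FourierOnCircle

open Real Set

/-- A continuous function on the unit circle all of whose Fourier coefficients vanish is zero. -/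
theorem eqOn_zero_of_circleAverage_mul_zpow_eq_zero {F : ℂ → ℂ}
    (hF : ContinuousOn F (sphere 0 1))
    (h : ∀ n : ℤ, circleAverage (fun z ↦ F z * z ^ n) 0 1 = 0) :
    EqOn F 0 (sphere 0 1) := by
  have : Fact (0 < 2 * π) := ⟨two_pi_pos⟩
  let P : C(AddCircle (2 * π), ℂ) :=
    ⟨fun x ↦ F (AddCircle.toCircle x), hF.comp_continuous (by fun_prop) fun x ↦ by
      rw [mem_sphere_zero_iff_norm, Circle.norm_coe]⟩
  have hcoe (x : ℝ) : (AddCircle.toCircle (x : AddCircle (2 * π)) : ℂ) = circleMap 0 1 x := by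
    simp [AddCircle.toCircle_apply_mk, circleMap, Circle.coe_exp]
  have hP : fourierCoeff P = 0 := by
    funext n
    have := h (-n)
    rw [circleAverage_def, smul_eq_zero_iff_right (by positivity)] at this
    rw [fourierCoeff_eq_intervalIntegral _ _ 0, zero_add]
    convert! smul_zero _
    rw [← this]
    refine intervalIntegral.integral_congr fun x _ ↦ ?_
    simp only [fourier_apply, AddCircle.toCircle_zsmul, Circle.coe_zpow, hcoe, P,
      ContinuousMap.coe_mk, smul_eq_mul, mul_comm]
  have hsum := hasSum_fourier_series_of_summable (f := P) (by rw [hP]; exact summable_zero)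
  have hP0 : P = 0 := hsum.unique (by simp only [hP, Pi.zero_apply, zero_smul]; exact hasSum_zero)
  intro z hz
  rw [← abs_one (α := ℝ), ← range_circleMap] at hz
  obtain ⟨θ, rfl⟩ := hz
  simpa [P, hcoe] using DFunLike.congr_fun hP0 (θ : AddCircle (2 * π))

/-- Conjugation commutes with averages over circles. -/
theorem circleAverage_conj (F : ℂ → ℂ) (c : ℂ) (R : ℝ) :
    circleAverage (fun z ↦ (starRingEnd ℂ) (F z)) c R =
      (starRingEnd ℂ) (circleAverage F c R) := by
  simp only [circleAverage_def, intervalIntegral.intervalIntegral_conj, Complex.real_smul, map_mul,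
    Complex.conj_ofReal]

/-- If `F` is invariant under the involution `w ↦ σ / w` of the annulus `|σ| ≤ |w| ≤ 1`,
then its Laurent coefficients of opposite indices are proportional. -/
theorem circleAverage_mul_zpow_eq_of_involution {F : ℂ → ℂ} {σ : ℝ} (hσ : σ ≠ 0) (hσ1 : |σ| ≤ 1)
    (hc : ContinuousOn F (closedBall 0 1 \ ball 0 |σ|))
    (hd : ∀ z ∈ ball (0 : ℂ) 1 \ closedBall 0 |σ|, DifferentiableAt ℂ F z)
    (hinv : ∀ w ≠ 0, F (σ / w) = F w) (n : ℤ) :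
    circleAverage (fun z ↦ F z * z ^ n) 0 1 =
      σ ^ n * circleAverage (fun z ↦ F z * z ^ (-n)) 0 1 := by
  have hpos : 0 < |σ| := abs_pos.2 hσ
  have hne {z : ℂ} (hz : z ∉ ball (0 : ℂ) |σ|) : z ≠ 0 := by
    rintro rfl; exact hz (mem_ball_self hpos)
  calc circleAverage (fun z ↦ F z * z ^ n) 0 1
    _ = circleAverage (fun z ↦ F z * z ^ n) 0 |σ| := by
      rw [circleAverage_eq_circleIntegral one_ne_zero, circleAverage_eq_circleIntegral hpos.ne',
        Complex.circleIntegral_sub_center_inv_smul_eq_of_differentiable_on_annulus_off_countable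
          hpos hσ1 countable_empty]
      · exact hc.mul fun z hz ↦ (continuousAt_zpow₀ z n (.inl (hne hz.2))).continuousWithinAt
      · intro z hz
        refine (hd z hz.1).mul (differentiableAt_zpow.2 (.inl (hne fun h ↦ hz.1.2 ?_)))
        exact ball_subset_closedBall h
    _ = circleAverage (fun z ↦ F (σ * z) * (σ * z) ^ n) 0 1 := by
      rw [circleAverage_abs_radius, circleAverage_eq_circleAverage_zero_one]
      simp
    _ = circleAverage (fun z ↦ (σ : ℂ) ^ n • (F z⁻¹ * z⁻¹ ^ (-n))) 0 1 := by
      refine circleAverage_congr_sphere fun z hz ↦ ?_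
      have hz0 : z ≠ 0 := by rintro rfl; simp at hz
      have hσ' : (σ : ℂ) ≠ 0 := by exact_mod_cast hσ
      rw [← hinv (σ * z) (mul_ne_zero hσ' hz0), mul_zpow, div_mul_cancel_left₀ hσ', inv_zpow',
        neg_neg, smul_eq_mul]
      ring
    _ = σ ^ n * circleAverage (fun z ↦ F z * z ^ (-n)) 0 1 := by
      rw [circleAverage_fun_smul, circleAverage_zero_one_congr_inv (f := fun z ↦ F z * z ^ (-n)),
        smul_eq_mul]

/-- Let `F` be holomorphic on an annulus and invariant under the involution `w ↦ σ / w`.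
If on the unit circle `conj (F w⁻¹)` agrees with a function that is holomorphic in the disk
and vanishes at its center, then `F` vanishes on the unit circle. -/
theorem eqOn_zero_of_involution_of_conj_eq {F K : ℂ → ℂ} {σ : ℝ} (hσ : σ ≠ 0) (hσ1 : |σ| ≤ 1)
    (hc : ContinuousOn F (closedBall 0 1 \ ball 0 |σ|))
    (hd : ∀ z ∈ ball (0 : ℂ) 1 \ closedBall 0 |σ|, DifferentiableAt ℂ F z)
    (hinv : ∀ w ≠ 0, F (σ / w) = F w)
    (hKc : ContinuousOn K (closedBall 0 1))
    (hKd : ∀ z ∈ ball (0 : ℂ) 1 \ {0}, DifferentiableAt ℂ K z) (hK0 : K 0 = 0)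
    (hFK : ∀ w ∈ sphere (0 : ℂ) 1, F w⁻¹ = (starRingEnd ℂ) (K w)) :
    EqOn F 0 (sphere 0 1) := by
  have hnonneg (n : ℕ) : circleAverage (fun z ↦ F z * z ^ (n : ℤ)) 0 1 = 0 := by
    calc circleAverage (fun z ↦ F z * z ^ (n : ℤ)) 0 1
      _ = circleAverage (fun z ↦ F z⁻¹ * z⁻¹ ^ (n : ℤ)) 0 1 :=
        (circleAverage_zero_one_congr_inv (f := fun z ↦ F z * z ^ (n : ℤ))).symm
      _ = circleAverage (fun z ↦ (starRingEnd ℂ) (K z * z ^ n)) 0 1 := by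
        refine circleAverage_congr_sphere fun z hz ↦ ?_
        rw [abs_one] at hz
        have hz' : z⁻¹ = (starRingEnd ℂ) z := Complex.inv_eq_conj (by simpa using hz)
        rw [hFK z hz, hz', zpow_natCast, map_mul, map_pow]
      _ = 0 := by
        rw [circleAverage_conj,
          circleAverage_of_differentiable_on_off_countable (countable_singleton 0), hK0, zero_mul,
          map_zero]
        · rw [abs_one]
          fun_prop
        · intro z hz
          rw [abs_one] at hz
          exact (hKd z hz).mul (by fun_prop)
  refine eqOn_zero_of_circleAverage_mul_zpow_eq_zero (hc.mono fun z hz ↦ ?_) fun n ↦ ?_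
  · simp only [mem_sphere_iff_norm, sub_zero] at hz
    simp [hz, hσ1]
  · obtain ⟨m, rfl | rfl⟩ := n.eq_nat_or_neg
    · exact hnonneg m
    · rw [circleAverage_mul_zpow_eq_of_involution hσ hσ1 hc hd hinv, neg_neg, hnonneg, mul_zero]

end FourierOnCircle

section Joukowski

/-- The Joukowski-type map `w ↦ α w + β / w`, which sends the unit circle to the ellipse with
semi-axes `α + β` and `α - β`. -/
noncomputable def joukowski (α β : ℝ) (w : ℂ) : ℂ := α * w + β / w

/-- The quadratic form defining the ellipse with semi-axes `a` and `b`. -/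
noncomputable def ellipseForm (a b : ℝ) (z : ℂ) : ℝ := (z.re / a) ^ 2 + (z.im / b) ^ 2

variable {α β : ℝ}

theorem joukowski_involution (hα : α ≠ 0) (hβ : β ≠ 0) {w : ℂ} (hw : w ≠ 0) :
    joukowski α β ((β / α : ℝ) / w) = joukowski α β w := by
  have hα' : (α : ℂ) ≠ 0 := by exact_mod_cast hα
  have hβ' : (β : ℂ) ≠ 0 := by exact_mod_cast hβ
  simp only [joukowski, Complex.ofReal_div]
  field_simp
  ring

theorem differentiableAt_joukowski {w : ℂ} (hw : w ≠ 0) :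
    DifferentiableAt ℂ (joukowski α β) w := by
  unfold joukowski
  fun_prop (disch := assumption)

theorem joukowski_inv (w : ℂ) : joukowski α β w⁻¹ = joukowski β α w := by
  simp [joukowski, div_eq_mul_inv, add_comm]

theorem tendsto_joukowski_nhdsNE_zero (hβ : β ≠ 0) :
    Tendsto (joukowski α β) (nhdsWithin 0 {0}ᶜ) (cocompact ℂ) := by
  rw [← cobounded_eq_cocompact]
  have h1 : Tendsto (fun w : ℂ ↦ (β : ℂ) * w⁻¹) (nhdsWithin 0 {0}ᶜ) (Bornology.cobounded ℂ) :=
    (tendsto_mul_left_cobounded (by exact_mod_cast hβ)).comp tendsto_inv₀_nhdsNE_zero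
  have h2 : Tendsto (fun w : ℂ ↦ (α : ℂ) * w) (nhdsWithin 0 {0}ᶜ) (nhds 0) := by
    have : Continuous fun w : ℂ ↦ (α : ℂ) * w := by fun_prop
    exact (this.tendsto' 0 0 (by simp)).mono_left nhdsWithin_le_nhds
  rw [← tendsto_norm_atTop_iff_cobounded] at h1 ⊢
  refine tendsto_atTop_mono (fun w ↦ ?_) (h1.atTop_add h2.norm.neg)
  have := norm_sub_le (joukowski α β w) (α * w)
  rw [joukowski, div_eq_mul_inv, add_sub_cancel_left] at this
  rw [joukowski, div_eq_mul_inv]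
  linarith

theorem ellipseForm_joukowski {w : ℂ} (hw : w ≠ 0) :
    ellipseForm (α + β) (α - β) (joukowski α β w) =
      ((α * ‖w‖ + β / ‖w‖) / (α + β)) ^ 2 * (w.re / ‖w‖) ^ 2 +
        ((α * ‖w‖ - β / ‖w‖) / (α - β)) ^ 2 * (w.im / ‖w‖) ^ 2 := by
  have hn : ‖w‖ ≠ 0 := norm_ne_zero_iff.2 hw
  have hre : (joukowski α β w).re = (α * ‖w‖ + β / ‖w‖) * (w.re / ‖w‖) := by
    simp only [joukowski, Complex.add_re, Complex.re_ofReal_mul, div_eq_mul_inv, Complex.inv_re,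
      Complex.normSq_eq_norm_sq]
    field_simp
  have him : (joukowski α β w).im = (α * ‖w‖ - β / ‖w‖) * (w.im / ‖w‖) := by
    simp only [joukowski, Complex.add_im, Complex.im_ofReal_mul, div_eq_mul_inv, Complex.inv_im,
      Complex.normSq_eq_norm_sq]
    field_simp
    ring
  rw [ellipseForm, hre, him]
  ring

theorem re_div_norm_sq_add_im_div_norm_sq {w : ℂ} (hw : w ≠ 0) :
    (w.re / ‖w‖) ^ 2 + (w.im / ‖w‖) ^ 2 = 1 := by
  have hn : ‖w‖ ≠ 0 := norm_ne_zero_iff.2 hw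
  have := Complex.sq_norm w
  rw [Complex.normSq_apply] at this
  field_simp
  linarith

theorem ellipseForm_joukowski_of_norm_eq_one (hαβ : |β| < α) {w : ℂ} (hw : ‖w‖ = 1) :
    ellipseForm (α + β) (α - β) (joukowski α β w) = 1 := by
  obtain ⟨h1, h2⟩ := abs_lt.1 hαβ
  have hw0 : w ≠ 0 := norm_ne_zero_iff.1 (by simp [hw])
  rw [ellipseForm_joukowski hw0, ← re_div_norm_sq_add_im_div_norm_sq hw0, hw]
  simp [div_self (by linarith : α + β ≠ 0), div_self (by linarith : α - β ≠ 0)]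

theorem one_lt_ellipseForm_joukowski (hαβ : |β| < α) {w : ℂ} (hw : 1 < ‖w‖) :
    1 < ellipseForm (α + β) (α - β) (joukowski α β w) := by
  obtain ⟨h1, h2⟩ := abs_lt.1 hαβ
  have hw0 : w ≠ 0 := norm_ne_zero_iff.1 (by linarith)
  have hsum := re_div_norm_sq_add_im_div_norm_sq hw0
  have hβ : |β / ‖w‖| < α := by
    rw [abs_div, abs_norm, div_lt_iff₀ (by linarith)]
    nlinarith [abs_nonneg β]
  obtain ⟨h3, h4⟩ := abs_lt.1 hβ
  have hmul : β / ‖w‖ * ‖w‖ = β := div_mul_cancel₀ _ (by linarith)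
  have hA : 1 < ((α * ‖w‖ + β / ‖w‖) / (α + β)) ^ 2 := by
    refine one_lt_pow₀ ((one_lt_div (by linarith)).2 ?_) two_ne_zero
    nlinarith
  have hB : 1 < ((α * ‖w‖ - β / ‖w‖) / (α - β)) ^ 2 := by
    refine one_lt_pow₀ ((one_lt_div (by linarith)).2 ?_) two_ne_zero
    nlinarith
  rw [ellipseForm_joukowski hw0, mul_comm, mul_comm (_ ^ 2) ((w.im / _) ^ 2)]
  exact convex_Ioi (1 : ℝ) hA hB (sq_nonneg _) (sq_nonneg _) hsum

theorem ellipseForm_joukowski_lt_one (hαβ : |β| < α) {w : ℂ} (hw : ‖w‖ < 1)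
    (hw' : |β| < α * ‖w‖) :
    ellipseForm (α + β) (α - β) (joukowski α β w) < 1 := by
  obtain ⟨h1, h2⟩ := abs_lt.1 hαβ
  have hn : 0 < ‖w‖ := by
    by_contra! h
    nlinarith [abs_nonneg β]
  have hw0 : w ≠ 0 := norm_pos_iff.1 hn
  have hsum := re_div_norm_sq_add_im_div_norm_sq hw0
  have hβ : |β / ‖w‖| < α := by
    rwa [abs_div, abs_norm, div_lt_iff₀ hn]
  obtain ⟨h3, h4⟩ := abs_lt.1 hβ
  have hmul : β / ‖w‖ * ‖w‖ = β := div_mul_cancel₀ _ hn.ne'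
  have hA : ((α * ‖w‖ + β / ‖w‖) / (α + β)) ^ 2 < 1 := by
    rw [sq_lt_one_iff_abs_lt_one, abs_lt, lt_div_iff₀ (by linarith), div_lt_one (by linarith)]
    constructor <;> nlinarith
  have hB : ((α * ‖w‖ - β / ‖w‖) / (α - β)) ^ 2 < 1 := by
    rw [sq_lt_one_iff_abs_lt_one, abs_lt, lt_div_iff₀ (by linarith), div_lt_one (by linarith)]
    constructor <;> nlinarith
  rw [ellipseForm_joukowski hw0, mul_comm, mul_comm (_ ^ 2) ((w.im / _) ^ 2)]
  exact convex_Iio (1 : ℝ) hA hB (sq_nonneg _) (sq_nonneg _) hsum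

theorem ellipseForm_joukowski_le_one (hαβ : |β| < α) {w : ℂ} (hw0 : w ≠ 0) (hw : ‖w‖ ≤ 1)
    (hw' : |β| ≤ α * ‖w‖) :
    ellipseForm (α + β) (α - β) (joukowski α β w) ≤ 1 := by
  obtain ⟨h1, h2⟩ := abs_lt.1 hαβ
  have hn : 0 < ‖w‖ := norm_pos_iff.2 hw0
  have hsum := re_div_norm_sq_add_im_div_norm_sq hw0
  have hβ : |β / ‖w‖| ≤ α := by
    rwa [abs_div, abs_norm, div_le_iff₀ hn]
  obtain ⟨h3, h4⟩ := abs_le.1 hβ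
  have hmul : β / ‖w‖ * ‖w‖ = β := div_mul_cancel₀ _ hn.ne'
  have hA : ((α * ‖w‖ + β / ‖w‖) / (α + β)) ^ 2 ≤ 1 := by
    rw [sq_le_one_iff_abs_le_one, abs_le, le_div_iff₀ (by linarith), div_le_one (by linarith)]
    constructor <;> nlinarith
  have hB : ((α * ‖w‖ - β / ‖w‖) / (α - β)) ^ 2 ≤ 1 := by
    rw [sq_le_one_iff_abs_le_one, abs_le, le_div_iff₀ (by linarith), div_le_one (by linarith)]
    constructor <;> nlinarith
  rw [ellipseForm_joukowski hw0, mul_comm, mul_comm (_ ^ 2) ((w.im / _) ^ 2)]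
  exact convex_Iic (1 : ℝ) hA hB (sq_nonneg _) (sq_nonneg _) hsum

theorem exists_joukowski_eq_of_ellipseForm_eq_one (hαβ : |β| < α) {z : ℂ}
    (hz : ellipseForm (α + β) (α - β) z = 1) :
    ∃ w : ℂ, ‖w‖ = 1 ∧ joukowski α β w = z := by
  obtain ⟨h1, h2⟩ := abs_lt.1 hαβ
  have ha : α + β ≠ 0 := by linarith
  have hb : α - β ≠ 0 := by linarith
  let w : ℂ := ⟨z.re / (α + β), z.im / (α - β)⟩
  have hw : ‖w‖ = 1 := by
    rw [← sq_eq_sq₀ (norm_nonneg _) zero_le_one, Complex.sq_norm, Complex.normSq_apply, one_pow,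
      ← hz, ellipseForm]
    ring
  refine ⟨w, hw, ?_⟩
  rw [joukowski, div_eq_mul_inv, Complex.inv_eq_conj hw]
  apply Complex.ext
  · simp only [w, Complex.add_re, Complex.re_ofReal_mul, Complex.conj_re]
    field_simp
  · simp only [w, Complex.add_im, Complex.im_ofReal_mul, Complex.conj_im]
    field_simp
    ring

theorem continuous_ellipseForm (a b : ℝ) : Continuous (ellipseForm a b) := by
  unfold ellipseForm
  fun_prop

theorem isOpen_ellipse (a b : ℝ) : IsOpen {z | ellipseForm a b z < 1} :=
  isOpen_lt (continuous_ellipseForm a b) continuous_const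

theorem ellipseForm_ofReal_mul (a b t : ℝ) (z : ℂ) :
    ellipseForm a b (t * z) = t ^ 2 * ellipseForm a b z := by
  simp only [ellipseForm, Complex.re_ofReal_mul, Complex.im_ofReal_mul]
  ring

theorem closure_ellipse (a b : ℝ) :
    closure {z | ellipseForm a b z < 1} = {z | ellipseForm a b z ≤ 1} := by
  refine (closure_lt_subset_le (continuous_ellipseForm a b) continuous_const).antisymm fun z hz ↦ ?_
  have hcont : Continuous fun t : ℝ ↦ (t : ℂ) * z := by fun_prop
  refine mem_closure_of_tendsto (b := nhdsWithin (1 : ℝ) (Set.Iio 1))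
    ((hcont.tendsto' 1 z (by simp)).mono_left nhdsWithin_le_nhds) ?_
  filter_upwards [Ioo_mem_nhdsLT (zero_lt_one' ℝ)] with t ht
  have h0 : 0 ≤ ellipseForm a b z := by unfold ellipseForm; positivity
  have hz' : ellipseForm a b z ≤ 1 := hz
  change ellipseForm a b (t * z) < 1
  rw [ellipseForm_ofReal_mul]
  nlinarith [ht.1, ht.2]

theorem frontier_ellipse (a b : ℝ) :
    frontier {z | ellipseForm a b z < 1} = {z | ellipseForm a b z = 1} := by
  ext z
  rw [(isOpen_ellipse a b).frontier_eq, closure_ellipse]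
  simp [le_antisymm_iff]

theorem isBounded_ellipse {a b : ℝ} (ha : 0 < a) (hb : 0 < b) :
    Bornology.IsBounded {z | ellipseForm a b z < 1} := by
  refine isBounded_iff_forall_norm_le.2 ⟨a + b, fun z hz ↦ ?_⟩
  have hz' : (z.re / a) ^ 2 + (z.im / b) ^ 2 < 1 := hz
  have h1 : |z.re / a| ≤ 1 := by
    rw [← sq_le_one_iff_abs_le_one]; nlinarith [sq_nonneg (z.im / b)]
  have h2 : |z.im / b| ≤ 1 := by
    rw [← sq_le_one_iff_abs_le_one]; nlinarith [sq_nonneg (z.re / a)]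
  rw [abs_div, abs_of_pos ha, div_le_one ha] at h1
  rw [abs_div, abs_of_pos hb, div_le_one hb] at h2
  exact (Complex.norm_le_abs_re_add_abs_im z).trans (add_le_add h1 h2)

end Joukowski

/-- The first function of a matching pair for a non-circular ellipse vanishes on the ellipse. -/
theorem IsMatchingPair.eq_zero_of_ellipseForm_eq_one {α β : ℝ} (hαβ : |β| < α) (hβ : β ≠ 0)
    {f g : ℂ → ℂ} (hfg : IsMatchingPair {z | ellipseForm (α + β) (α - β) z < 1} f g) {z : ℂ}
    (hz : ellipseForm (α + β) (α - β) z = 1) : f z = 0 := by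
  obtain ⟨hfc, hfd, hgc, hgd, hg0, hfr⟩ := hfg
  rw [closure_ellipse] at hfc hgd
  rw [frontier_ellipse] at hfr
  have hα : 0 < α := (abs_nonneg β).trans_lt hαβ
  have hpos : 0 < |β / α| := abs_pos.2 (div_ne_zero hβ hα.ne')
  have hσ : |β / α| = |β| / α := by rw [abs_div, abs_of_pos hα]
  obtain ⟨w, hw, rfl⟩ := exists_joukowski_eq_of_ellipseForm_eq_one hαβ hz
  let K : ℂ → ℂ := Function.update (fun u ↦ g (joukowski β α u)) 0 0
  have hK {u : ℂ} (hu : u ≠ 0) : K u = g (joukowski β α u) := Function.update_of_ne hu _ _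
  have hcirc {u : ℂ} (hu : ‖u‖ = 1) := ellipseForm_joukowski_of_norm_eq_one hαβ hu
  have hout {u : ℂ} (hu0 : u ≠ 0) (hu : ‖u‖ < 1) :
      1 < ellipseForm (α + β) (α - β) (joukowski β α u) := by
    rw [← joukowski_inv]
    refine one_lt_ellipseForm_joukowski hαβ ?_
    rw [norm_inv]
    exact (one_lt_inv₀ (norm_pos_iff.2 hu0)).2 hu
  refine eqOn_zero_of_involution_of_conj_eq (F := fun w ↦ f (joukowski α β w)) (K := K)
    (σ := β / α) (div_ne_zero hβ hα.ne') ?_ ?_ ?_ ?_ ?_ ?_ ?_ ?_ (by simpa using hw)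
  · rw [hσ]
    exact ((div_lt_one hα).2 hαβ).le
  · have hne : ∀ u ∈ closedBall (0 : ℂ) 1 \ ball 0 |β / α|, u ≠ 0 := by
      rintro u hu rfl
      exact hu.2 (mem_ball_self hpos)
    refine hfc.comp (fun u hu ↦ ?_) fun u hu ↦ ?_
    · exact (differentiableAt_joukowski (hne u hu)).continuousAt.continuousWithinAt
    · refine ellipseForm_joukowski_le_one hαβ (hne u hu) (by simpa using hu.1) ?_
      have := hu.2
      rwa [mem_ball_zero_iff, not_lt, hσ, div_le_iff₀' hα] at this
  · intro u hu
    have h2 := hu.2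
    rw [mem_closedBall_zero_iff, not_le] at h2
    refine (hfd _ ?_).comp u (differentiableAt_joukowski (norm_pos_iff.1 (hpos.trans h2)))
    rw [hσ, div_lt_iff₀' hα] at h2
    exact ellipseForm_joukowski_lt_one hαβ (by simpa using hu.1) h2
  · intro u hu
    exact congrArg f (joukowski_involution hα.ne' hβ hu)
  · intro u hu
    rcases eq_or_ne u 0 with rfl | hu0
    · exact (continuousAt_update_same.2
        (hg0.comp (tendsto_joukowski_nhdsNE_zero hα.ne'))).continuousWithinAt
    · have hmaps : Set.MapsTo (joukowski β α) (closedBall 0 1 \ {0})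
          {z | ellipseForm (α + β) (α - β) z < 1}ᶜ := by
        intro v hv
        have hv1 : ‖v‖ ≤ 1 := by simpa using hv.1
        simp only [Set.mem_compl_iff, Set.mem_ofPred_eq, not_lt]
        rcases hv1.lt_or_eq with h | h
        · exact (hout hv.2 h).le
        · rw [← joukowski_inv, hcirc (by simp [h])]
      have hcomp : ContinuousWithinAt (fun u ↦ g (joukowski β α u)) (closedBall 0 1 \ {0}) u :=
        (hgc _ (hmaps ⟨hu, hu0⟩)).comp
          (differentiableAt_joukowski hu0).continuousAt.continuousWithinAt hmaps
      rw [continuousWithinAt_update_of_ne hu0]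
      refine hcomp.mono_of_mem_nhdsWithin ?_
      exact Filter.inter_mem self_mem_nhdsWithin
        (mem_nhdsWithin_of_mem_nhds (isOpen_compl_singleton.mem_nhds hu0))
  · intro u hu
    have hu0 : u ≠ 0 := hu.2
    have hd : DifferentiableAt ℂ (fun u ↦ g (joukowski β α u)) u :=
      (hgd _ (by simpa using hout hu0 (by simpa using hu.1))).comp u
        (differentiableAt_joukowski hu0)
    refine hd.congr_of_eventuallyEq ?_
    filter_upwards [isOpen_compl_singleton.mem_nhds hu0] with v hv using hK hv
  · exact Function.update_self ..
  · intro u hu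
    have hu1 : ‖u‖ = 1 := by simpa using hu
    have hu0 : u ≠ 0 := norm_ne_zero_iff.1 (by simp [hu1])
    rw [hK hu0, ← joukowski_inv (α := α)]
    exact hfr _ (hcirc (by rw [norm_inv, hu1, inv_one]))

/-- Theorem 3.21: for the interior of a non-circular ellipse the matching problem has
only the trivial solution. -/
theorem ellipse_matching_trivial
    (a b : ℝ) (ha : 0 < a) (hb : 0 < b) (hab : a ≠ b)
    (Ω : Set ℂ) (hΩ : Ω = {z : ℂ | (z.re / a) ^ 2 + (z.im / b) ^ 2 < 1})
    (f g : ℂ → ℂ) (hfg : IsMatchingPair Ω f g) :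
    ∃ k : ℂ, ∀ z ∈ Ω, f z = k := by
  obtain ⟨α, β, rfl, rfl⟩ : ∃ α β : ℝ, a = α + β ∧ b = α - β :=
    ⟨(a + b) / 2, (a - b) / 2, by ring, by ring⟩
  change Ω = {z | ellipseForm (α + β) (α - β) z < 1} at hΩ
  subst hΩ
  have hβ : β ≠ 0 := by
    rintro rfl
    simp at hab
  have hαβ : |β| < α := abs_lt.2 ⟨by linarith, by linarith⟩
  refine ⟨0, Complex.eqOn_of_eqOn_frontier (isBounded_ellipse ha hb)
    ⟨fun z hz ↦ (hfg.2.1 z hz).differentiableWithinAt, hfg.1⟩ diffContOnCl_const fun z hz ↦ ?_⟩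
  rw [frontier_ellipse] at hz
  exact hfg.eq_zero_of_ellipseForm_eq_one hαβ hβ hz
end

section
/- Let P be a monic complex polynomial of degree ≥ 1 and suppose Ω := {z ∈ ℂ : ‖P(z)‖ < 1} is a Jordan domain, i.e. Ω is nonempty, connected, and its frontier is the image of a continuous injective map from the circle into ℂ. Suppose moreover that Ω is a quadrature domain: there exist a finite set T ⊆ Ω and a function S : ℂ → ℂ that is continuous on (closure Ω) ∖ T, complex-differentiable at every point of Ω ∖ T, and satisfies S(z) = conj(z) for every z in the frontier of Ω. Then Ω is a disk: there exist a ∈ ℂ and r > 0 with Ω = Metric.ball a r. -/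
open Metric Polynomial

open Filter Topology Asymptotics in
/-- If the composition of a polynomial `Q` of degree `n` with a function `S` holomorphic in a
punctured neighbourhood of `a` is reciprocal to a polynomial `P`, then `a` is a zero of `P` of
multiplicity at least `n`. -/
theorem natDegree_le_rootMultiplicity_of_eval_mul_eval_eq_one {P Q : Polynomial ℂ} (hQ : Q ≠ 0)
    {S : ℂ → ℂ} {a : ℂ} (ha : P.eval a = 0)
    (hS : ∀ᶠ z in 𝓝[≠] a, DifferentiableAt ℂ S z)
    (hPQ : ∀ᶠ z in 𝓝[≠] a, Q.eval (S z) * P.eval z = 1) :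
    Q.natDegree ≤ P.rootMultiplicity a := by
  by_contra! hlt
  set n := Q.natDegree with hn
  have hn0 : n ≠ 0 := by omega
  have hP : P ≠ 0 := by
    rintro rfl
    obtain ⟨z, hz⟩ := hPQ.exists
    simp at hz
  obtain ⟨q, hq, hqa⟩ := P.exists_eq_pow_rootMultiplicity_mul_and_not_dvd hP a
  set k := P.rootMultiplicity a
  rw [dvd_iff_isRoot, IsRoot.def] at hqa
  obtain ⟨c, R, hcR⟩ : ∃ c R : ℝ, ∀ w : ℂ, ‖w‖ ^ n ≤ c * ‖Q.eval w‖ + R := by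
    have h : (fun w : ℂ => (X ^ n : Polynomial ℂ).eval w) =O[Bornology.cobounded ℂ] Q.eval :=
      isBigO_cobounded_of_degree_le (by rw [degree_X_pow, degree_eq_natDegree hQ])
    obtain ⟨c, hc, h⟩ := h.exists_pos
    obtain ⟨R, -, hR⟩ := (hasBasis_cobounded_norm (E := ℂ)).eventually_iff.1 h.bound
    refine ⟨c, (max R 0) ^ n, fun w => ?_⟩
    rcases le_total R ‖w‖ with hw | hw
    · have := hR hw
      simp only [eval_pow, eval_X, norm_pow] at this
      have : 0 ≤ max R 0 ^ n := by positivity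
      linarith
    · have : ‖w‖ ^ n ≤ max R 0 ^ n := by gcongr; exact hw.trans (le_max_left _ _)
      have : 0 ≤ c * ‖Q.eval w‖ := by positivity
      linarith
  have hpow : Tendsto (fun z => ‖(z - a) * S z‖ ^ n) (𝓝[≠] a) (𝓝 0) := by
    have hbd : Tendsto (fun z => c * (‖z - a‖ ^ (n - k) / ‖q.eval z‖) + R * ‖z - a‖ ^ n)
        (𝓝[≠] a) (𝓝 0) := by
      have hcont : ContinuousAt
          (fun z => c * (‖z - a‖ ^ (n - k) / ‖q.eval z‖) + R * ‖z - a‖ ^ n) a := by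
        have := q.continuous.continuousAt (x := a)
        fun_prop (disch := simpa using hqa)
      have := hcont.tendsto.mono_left (nhdsWithin_le_nhds (s := {a}ᶜ))
      simpa [hn0, Nat.sub_ne_zero_of_lt hlt] using this
    refine squeeze_zero' (.of_forall fun z => by positivity) ?_ hbd
    filter_upwards [hPQ, self_mem_nhdsWithin] with z hz hza
    have hza : 0 < ‖z - a‖ := by simpa [sub_eq_zero] using hza
    have hPz : P.eval z = (z - a) ^ k * q.eval z := by
      conv_lhs => rw [hq]
      simp
    have hq0 : q.eval z ≠ 0 := by
      intro h
      simp [hPz, h] at hz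
    have hq0 : 0 < ‖q.eval z‖ := by simpa using hq0
    have hQz : ‖Q.eval (S z)‖ * (‖z - a‖ ^ k * ‖q.eval z‖) = 1 := by
      rw [hPz] at hz
      simpa using congrArg norm hz
    have hnk : ‖z - a‖ ^ n = ‖z - a‖ ^ (n - k) * ‖z - a‖ ^ k := by
      rw [← pow_add, Nat.sub_add_cancel hlt.le]
    calc ‖(z - a) * S z‖ ^ n = ‖z - a‖ ^ n * ‖S z‖ ^ n := by rw [norm_mul, mul_pow]
      _ ≤ ‖z - a‖ ^ n * (c * ‖Q.eval (S z)‖ + R) := by gcongr; exact hcR _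
      _ = c * (‖z - a‖ ^ (n - k) / ‖q.eval z‖) + R * ‖z - a‖ ^ n := by
        have : ‖z - a‖ ^ n * ‖Q.eval (S z)‖ = ‖z - a‖ ^ (n - k) / ‖q.eval z‖ := by
          rw [eq_div_iff hq0.ne', hnk]
          linear_combination ‖z - a‖ ^ (n - k) * hQz
        rw [← this]
        ring
  have hlim : Tendsto (fun z => (z - a) * S z) (𝓝[≠] a) (𝓝 0) := by
    rw [tendsto_zero_iff_norm_tendsto_zero]
    have h := (Real.continuousAt_rpow_const 0 ((n : ℝ)⁻¹) (Or.inr (by positivity))).tendsto.comp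
      hpow
    rw [Real.zero_rpow (by positivity)] at h
    refine h.congr fun z => ?_
    exact Real.pow_rpow_inv_natCast (norm_nonneg _) hn0
  have hlittle : (fun z => S z - S a) =o[𝓝[≠] a] fun z => (z - a)⁻¹ := by
    have hne : ∀ᶠ z in 𝓝[≠] a, (z - a)⁻¹ = 0 → S z - S a = 0 := by
      filter_upwards [self_mem_nhdsWithin] with z hz h
      exact absurd (by simpa [sub_eq_zero] using h) hz
    rw [isLittleO_iff_tendsto' hne]
    have h0 : Tendsto (fun z => (z - a) * S a) (𝓝[≠] a) (𝓝 0) := by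
      have : ContinuousAt (fun z => (z - a) * S a) a := by fun_prop
      simpa using this.tendsto.mono_left (nhdsWithin_le_nhds (s := {a}ᶜ))
    refine (by simpa using hlim.sub h0 : Tendsto _ _ (𝓝 (0 : ℂ))).congr fun z => ?_
    rw [div_inv_eq_mul]
    ring
  have hT := Complex.tendsto_limUnder_of_differentiable_on_punctured_nhds_of_isLittleO hS hlittle
  have h1 := ((Q.continuous.tendsto _).comp hT).mul
    ((P.continuous.tendsto a).mono_left (nhdsWithin_le_nhds (s := {a}ᶜ)))
  rw [ha, mul_zero] at h1
  exact one_ne_zero (tendsto_nhds_unique (tendsto_const_nhds.congr' (hPQ.mono fun _ h => h.symm)) h1)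

theorem isPreconnected_ball_diff_center (a : ℂ) (r : ℝ) : IsPreconnected (ball a r \ {a}) := by
  have h : IsPreconnected
      ((fun x : ℝ × ℝ => a + x.1 * Complex.exp (x.2 * Complex.I)) '' (Set.Ioo 0 r ×ˢ Set.univ)) :=
    (isPreconnected_Ioo.prod isPreconnected_univ).image _ (by fun_prop)
  convert h using 1
  ext z
  simp only [Set.mem_sdiff, mem_ball, Set.mem_singleton_iff, Set.mem_image, Set.mem_prod,
    Set.mem_Ioo, Set.mem_univ, and_true, Prod.exists]
  constructor
  · rintro ⟨hz, hza⟩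
    refine ⟨‖z - a‖, Complex.arg (z - a), ⟨by simpa [sub_eq_zero] using hza, ?_⟩, ?_⟩
    · rwa [← dist_eq_norm]
    · rw [Complex.norm_mul_exp_arg_mul_I]
      ring
  · rintro ⟨s, t, ⟨hs, hsr⟩, rfl⟩
    simp [dist_eq_norm, Complex.norm_exp_ofReal_mul_I, abs_of_pos hs, hsr, hs.ne']

theorem IsOpen.isPreconnected_diff_singleton {U : Set ℂ} (hU : IsOpen U) (hc : IsPreconnected U)
    (a : ℂ) : IsPreconnected (U \ {a}) := by
  by_cases ha : a ∈ U
  swap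
  · rwa [Set.sdiff_singleton_eq_self ha]
  obtain ⟨r, hr, hrU⟩ := Metric.isOpen_iff.1 hU a ha
  have hsub : ball a r \ {a} ⊆ U \ {a} := Set.sdiff_subset_sdiff_left hrU
  rw [isPreconnected_iff_subset_of_disjoint] at hc ⊢
  have key : ∀ u v : Set ℂ, IsOpen u → IsOpen v → U \ {a} ⊆ u ∪ v → (U \ {a}) ∩ (u ∩ v) = ∅ →
      ball a r \ {a} ⊆ u → U \ {a} ⊆ u ∨ U \ {a} ⊆ v := by
    intro u v hu hv huv hd hb
    have hdis : ∀ z ∈ U \ {a}, z ∈ u → z ∉ v := fun z hz hzu hzv => by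
      have : z ∈ (U \ {a}) ∩ (u ∩ v) := ⟨hz, hzu, hzv⟩
      simp [hd] at this
    have hav : ∀ z ∈ ball a r, z ∉ v \ {a} := fun z hz hzv =>
      hdis z (hsub ⟨hz, hzv.2⟩) (hb ⟨hz, hzv.2⟩) hzv.1
    have hcover : U ⊆ (u ∪ ball a r) ∪ (v \ {a}) := fun z hz => by
      by_cases hza : z = a
      · exact Or.inl (Or.inr (by simp [hza, hr]))
      · rcases huv ⟨hz, hza⟩ with h | h
        exacts [Or.inl (Or.inl h), Or.inr ⟨h, hza⟩]
    have hempty : U ∩ ((u ∪ ball a r) ∩ (v \ {a})) = ∅ := by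
      rw [Set.eq_empty_iff_forall_notMem]
      rintro z ⟨hz, h | h, hzv⟩
      exacts [hdis z ⟨hz, hzv.2⟩ h hzv.1, hav z h hzv]
    rcases hc _ _ (hu.union isOpen_ball) (hv.sdiff isClosed_singleton) hcover hempty with h | h
    · left
      intro z hz
      rcases h hz.1 with h | h
      exacts [h, hb ⟨h, hz.2⟩]
    · exact absurd rfl (h ha).2
  intro u v hu hv huv hd
  have hball := isPreconnected_iff_subset_of_disjoint.1 (isPreconnected_ball_diff_center a r)
    u v hu hv (hsub.trans huv) (Set.subset_empty_iff.1
      ((Set.inter_subset_inter_left _ hsub).trans hd.subset))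
  rcases hball with h | h
  · exact key u v hu hv huv hd h
  · exact (key v u hv hu (by rwa [Set.union_comm]) (by rwa [Set.inter_comm v u]) h).symm

theorem IsOpen.isPreconnected_diff_finite {U T : Set ℂ} (hU : IsOpen U) (hc : IsPreconnected U)
    (hT : T.Finite) : IsPreconnected (U \ T) := by
  induction T, hT using Set.Finite.induction_on with
  | empty => simpa
  | @insert a s _ hs ih =>
    rw [← Set.union_singleton, ← Set.sdiff_sdiff]
    exact (hU.sdiff hs.isClosed).isPreconnected_diff_singleton ih a

open Filter Topology in
/-- Local boundary uniqueness at a boundary point `z₀` admitting a holomorphic peak function. -/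
theorem Complex.eventually_eq_zero_of_eq_zero_on_frontier {U : Set ℂ} (hU : IsOpen U) {z₀ : ℂ}
    {r : ℝ} (hr : 0 < r) {F g : ℂ → ℂ}
    (hFc : ContinuousOn F (closure U ∩ closedBall z₀ r))
    (hFd : DifferentiableOn ℂ F (U ∩ ball z₀ r))
    (hF0 : ∀ z ∈ frontier U ∩ closedBall z₀ r, F z = 0)
    (hg : Differentiable ℂ g) (hgz : g z₀ = 1)
    (hpeak : ∀ z ∈ closure U ∩ sphere z₀ r, ‖g z‖ < 1) :
    ∀ᶠ z in 𝓝 z₀, z ∈ U → F z = 0 := by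
  have hK : IsCompact (closure U ∩ sphere z₀ r) :=
    (isCompact_sphere z₀ r).inter_left isClosed_closure
  obtain ⟨ρ, hρ0, hρ1, hρ⟩ : ∃ ρ : ℝ, 0 ≤ ρ ∧ ρ < 1 ∧
      ∀ z ∈ closure U ∩ sphere z₀ r, ‖g z‖ ≤ ρ := by
    rcases (closure U ∩ sphere z₀ r).eq_empty_or_nonempty with he | hne
    · exact ⟨0, le_rfl, one_pos, by simp [he]⟩
    · obtain ⟨w, hw, hmax⟩ := hK.exists_isMaxOn hne hg.continuous.norm.continuousOn
      exact ⟨‖g w‖, norm_nonneg _, hpeak w hw, fun z hz => hmax hz⟩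
  obtain ⟨M, hM⟩ := ((isCompact_closedBall z₀ r).inter_left
    (isClosed_closure (s := U))).exists_bound_of_continuousOn hFc
  have hcl : closure (U ∩ ball z₀ r) ⊆ closure U ∩ closedBall z₀ r :=
    (closure_inter_subset_inter_closure _ _).trans
      (Set.inter_subset_inter_right _ closure_ball_subset_closedBall)
  have hbound : ∀ N : ℕ, ∀ z ∈ U ∩ ball z₀ r, ‖F z * g z ^ N‖ ≤ max M 0 * ρ ^ N := by
    intro N z hz
    refine norm_le_of_forall_mem_frontier_norm_le (f := fun z => F z * g z ^ N)
      (isBounded_ball.subset (Set.inter_subset_right (s := U)))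
      ⟨hFd.mul (hg.pow N).differentiableOn,
        (hFc.mono hcl).mul (hg.pow N).continuous.continuousOn⟩ (fun w hw => ?_)
      (subset_closure hz)
    have hwcl := hcl hw.1
    rw [(hU.inter isOpen_ball).frontier_eq] at hw
    by_cases hwU : w ∈ U
    · have hws : w ∈ sphere z₀ r := by
        have h1 : ¬ dist w z₀ < r := fun h => hw.2 ⟨hwU, h⟩
        exact le_antisymm hwcl.2 (not_lt.1 h1)
      rw [norm_mul, norm_pow]
      gcongr
      · exact (hM w hwcl).trans (le_max_left _ _)
      · exact hρ w ⟨hwcl.1, hws⟩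
    · rw [hF0 w ⟨by rw [hU.frontier_eq]; exact ⟨hwcl.1, hwU⟩, hwcl.2⟩]
      simp only [zero_mul, norm_zero]
      positivity
  have hev : ∀ᶠ z in 𝓝 z₀, ρ < ‖g z‖ :=
    hg.continuous.norm.continuousAt.eventually_const_lt (by simpa [hgz] using hρ1)
  filter_upwards [hev, ball_mem_nhds z₀ hr] with z hz hzr hzU
  have hgpos : 0 < ‖g z‖ := hρ0.trans_lt hz
  have hlim : Tendsto (fun N : ℕ => max M 0 * (ρ / ‖g z‖) ^ N) atTop (𝓝 0) := by
    simpa using (tendsto_pow_atTop_nhds_zero_of_lt_one (by positivity)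
      ((div_lt_one hgpos).2 hz)).const_mul (max M 0)
  have : ‖F z‖ ≤ 0 := ge_of_tendsto' hlim fun N => by
    rw [div_pow, ← mul_div_assoc, le_div_iff₀ (by positivity), ← norm_pow, ← norm_mul]
    exact hbound N z ⟨hzU, hzr⟩
  simpa using this

theorem Complex.norm_one_add_div_two_lt_one {q : ℂ} (hq : ‖q‖ ≤ 1) (h1 : q ≠ 1) :
    ‖(1 + q) / 2‖ < 1 := by
  have h : ‖1 + q‖ < 2 := by
    rcases hq.lt_or_eq with hq | hq
    · have := norm_add_le 1 q
      rw [norm_one] at this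
      linarith
    · refine lt_of_le_of_ne ?_ fun h => h1 ?_
      · have := norm_add_le 1 q
        rw [norm_one] at this
        linarith
      · have hray : SameRay ℝ 1 q := sameRay_iff_norm_add.2 (by rw [h, hq, norm_one]; norm_num)
        simpa [hq] using hray.norm_smul_eq
  rw [norm_div, Complex.norm_ofNat]
  linarith

/-- Theorem 4.2: a Jordan lemniscate domain `{|P| < 1}` of a monic polynomial `P` which is
also a quadrature domain must be a disk. -/
theorem jordan_lemniscate_quadrature_is_disk
    (P : Polynomial ℂ) (hmonic : P.Monic) (hdeg : 1 ≤ P.natDegree)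
    (Ω : Set ℂ) (hΩ : Ω = {z : ℂ | ‖P.eval z‖ < 1})
    (hne : Ω.Nonempty) (hconn : IsConnected Ω)
    -- Jordan domain: the frontier is a Jordan curve
    (hjordan : ∃ γ : Metric.sphere (0 : ℂ) 1 → ℂ, Continuous γ ∧ Function.Injective γ ∧
      frontier Ω = Set.range γ)
    -- quadrature domain: the Schwarz function extends meromorphically inside
    (T : Set ℂ) (hTfin : T.Finite) (hTΩ : T ⊆ Ω)
    (S : ℂ → ℂ) (hScont : ContinuousOn S (closure Ω \ T))
    (hSdiff : ∀ z ∈ Ω \ T, DifferentiableAt ℂ S z)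
    (hSbdry : ∀ z ∈ frontier Ω, S z = (starRingEnd ℂ) z) :
    ∃ (a : ℂ) (r : ℝ), 0 < r ∧ Ω = Metric.ball a r := by
  have hPn : Continuous fun z => ‖P.eval z‖ := P.continuous.norm
  have hopen : IsOpen Ω := hΩ ▸ isOpen_lt hPn continuous_const
  have hcl : ∀ z ∈ closure Ω, ‖P.eval z‖ ≤ 1 := fun z hz =>
    closure_lt_subset_le hPn continuous_const (hΩ ▸ hz)
  have hfr : ∀ z ∈ frontier Ω, ‖P.eval z‖ = 1 := fun z hz =>
    frontier_lt_subset_eq hPn continuous_const (hΩ ▸ hz)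
  have hopenT : IsOpen (Ω \ T) := hopen.sdiff hTfin.isClosed
  set Q := P.map (starRingEnd ℂ) with hQ
  have hQmonic : Q.Monic := hmonic.map _
  set F : ℂ → ℂ := fun z => Q.eval (S z) * P.eval z - 1 with hF
  have hFbdry : ∀ z ∈ frontier Ω, F z = 0 := fun z hz => by
    simp [hF, hQ, hSbdry z hz, eval_map_apply, Complex.conj_mul', hfr z hz]
  have hFcont : ContinuousOn F (closure Ω \ T) :=
    ((Q.continuous.comp_continuousOn hScont).mul P.continuous.continuousOn).sub continuousOn_const
  have hFdiff : DifferentiableOn ℂ F (Ω \ T) := fun z hz =>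
    (((Q.differentiable.differentiableAt.comp z (hSdiff z hz)).mul
      P.differentiable.differentiableAt).sub_const 1).differentiableWithinAt
  obtain ⟨z₀, hz₀⟩ : (frontier Ω).Nonempty := by
    obtain ⟨γ, -, -, hγ⟩ := hjordan
    exact hγ ▸ ⟨γ ⟨1, by simp⟩, Set.mem_range_self _⟩
  have hz₀T : z₀ ∉ T := fun h => by
    rw [hopen.frontier_eq] at hz₀
    exact hz₀.2 (hTΩ h)
  have hPz₀ : P.eval z₀ ≠ 0 := fun h => by simpa [h] using hfr z₀ hz₀
  have hfinite : {z | P.eval z = P.eval z₀}.Finite := by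
    have hne0 : P - C (P.eval z₀) ≠ 0 := fun h => by
      rw [sub_eq_zero.1 h, natDegree_C] at hdeg
      omega
    refine (P - C (P.eval z₀)).rootSet_finite ℂ |>.subset fun z hz => ?_
    rw [mem_rootSet]
    refine ⟨hne0, ?_⟩
    simpa [sub_eq_zero] using hz
  obtain ⟨r, hr, hrsub⟩ : ∃ r > 0,
      closedBall z₀ r ⊆ (T ∪ ({z | P.eval z = P.eval z₀} \ {z₀}))ᶜ :=
    nhds_basis_closedBall.mem_iff.1
      ((hTfin.union hfinite.sdiff).isClosed.isOpen_compl.mem_nhds (by simp [hz₀T]))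
  have hball : ∀ z ∈ closedBall z₀ r, z ∉ T ∧ (P.eval z = P.eval z₀ → z = z₀) := fun z hz => by
    simpa [not_or] using hrsub hz
  have hloc := Complex.eventually_eq_zero_of_eq_zero_on_frontier hopen hr
    (F := F) (g := fun z => (1 + P.eval z / P.eval z₀) / 2)
    (hFcont.mono fun z hz => ⟨hz.1, (hball z hz.2).1⟩)
    (hFdiff.mono fun z hz => ⟨hz.1, (hball z (ball_subset_closedBall hz.2)).1⟩)
    (fun z hz => hFbdry z hz.1)
    (((P.differentiable.div_const _).const_add 1).div_const 2)
    (by norm_num [hPz₀, one_add_one_eq_two])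
    (fun z hz => by
      refine Complex.norm_one_add_div_two_lt_one ?_ fun h => ?_
      · rw [norm_div, hfr z₀ hz₀, div_one]
        exact hcl z hz.1
      · have := (hball z (sphere_subset_closedBall hz.2)).2 ((div_eq_one_iff_eq hPz₀).1 h)
        rw [this] at hz
        have := hz.2
        simp at this
        exact hr.ne this)
  have hFzero : Set.EqOn F 0 (Ω \ T) := by
    obtain ⟨V, hVsub, hVo, hzV⟩ := _root_.eventually_nhds_iff.1
      (hloc.and (hTfin.isClosed.isOpen_compl.mem_nhds hz₀T))
    obtain ⟨w, hwV, hwΩ⟩ := mem_closure_iff.1 (frontier_subset_closure hz₀) V hVo hzV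
    refine (hFdiff.analyticOnNhd hopenT).eqOn_zero_of_preconnected_of_eventuallyEq_zero
      (hopen.isPreconnected_diff_finite hconn.isPreconnected hTfin)
      (z₀ := w) ⟨hwΩ, (hVsub w hwV).2⟩ ?_
    filter_upwards [hVo.mem_nhds hwV, hopen.mem_nhds hwΩ] with z hz hzΩ
    exact (hVsub z hz).1 hzΩ
  obtain ⟨a, ha⟩ : ∃ a, P.eval a = 0 :=
    IsAlgClosed.exists_root P (by rw [degree_eq_natDegree hmonic.ne_zero]; exact_mod_cast (by omega))
  have haΩ : a ∈ Ω := by simp [hΩ, ha]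
  have hpunct : ∀ᶠ z in nhdsWithin a {a}ᶜ, z ∈ Ω \ T := by
    have h1 : (T \ {a})ᶜ ∈ nhds a := hTfin.sdiff.isClosed.isOpen_compl.mem_nhds (by simp)
    filter_upwards [nhdsWithin_le_nhds h1, nhdsWithin_le_nhds (hopen.mem_nhds haΩ),
      self_mem_nhdsWithin] with z hz hzΩ hza
    exact ⟨hzΩ, fun h => hz ⟨h, hza⟩⟩
  have hmult := natDegree_le_rootMultiplicity_of_eval_mul_eval_eq_one hQmonic.ne_zero ha
    (hpunct.mono hSdiff) (hpunct.mono fun z hz => sub_eq_zero.1 (hFzero hz))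
  have hPeq : P = (X - C a) ^ P.natDegree := by
    rw [hQ, natDegree_map] at hmult
    refine eq_of_monic_of_dvd_of_natDegree_le ((monic_X_sub_C a).pow _) hmonic
      ((pow_dvd_pow _ hmult).trans (P.pow_rootMultiplicity_dvd a)) ?_
    simp
  refine ⟨a, 1, one_pos, ?_⟩
  ext z
  rw [hΩ, Set.mem_ofPred_eq, hPeq, mem_ball, dist_eq_norm]
  simp only [eval_pow, eval_sub, eval_X, eval_C, norm_pow]
  exact pow_lt_one_iff_of_nonneg (norm_nonneg _) (by omega)
end

section
/- Let Ω ⊆ ℂ be a nonempty bounded open connected set, let a ∈ Ω, and let S : ℂ → ℂ be continuous on (closure Ω) ∖ {a} and complex-differentiable at every point of Ω ∖ {a}, such that the function z ↦ (z − a) · (S(z) − conj(a)) extends to a function holomorphic on all of Ω and continuous on closure Ω, and such that S(z) = conj(z) for every z in the frontier of Ω. Then Ω is a disk centered at a: there exists r > 0 with Ω = Metric.ball a r. -/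
open Metric

/-- A function holomorphic on a bounded open set, continuous up to the boundary and real-valued on
the frontier is real-valued on the closure. -/
theorem im_eq_zero_of_forall_mem_frontier_im_eq_zero {U : Set ℂ} {f : ℂ → ℂ}
    (hU : Bornology.IsBounded U) (hf : DiffContOnCl ℂ f U)
    (h : ∀ z ∈ frontier U, (f z).im = 0) {z : ℂ} (hz : z ∈ closure U) : (f z).im = 0 := by
  have bound : ∀ c : ℂ, c.re = 0 → (c * f z).re ≤ 0 := by
    intro c hc
    have hexp : DiffContOnCl ℂ (fun w => Complex.exp (c * f w)) U :=
      Complex.differentiable_exp.comp_diffContOnCl (hf.const_smul c)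
    have := Complex.norm_le_of_forall_mem_frontier_norm_le hU hexp (C := 1)
      (fun w hw => by simp [Complex.norm_exp, hc, h w hw]) hz
    simpa [Complex.norm_exp] using this
  have h₁ := bound Complex.I (by simp)
  have h₂ := bound (-Complex.I) (by simp)
  simp at h₁ h₂
  linarith

/-- A bounded open set whose frontier lies on a circle and which contains the centre of that circle
is the disk bounded by the circle. -/
theorem eq_ball_of_frontier_subset_sphere {U : Set ℂ} {a : ℂ} {r : ℝ} (hr : 0 < r)
    (hU : Bornology.IsBounded U) (hUo : IsOpen U) (ha : a ∈ U)
    (h : frontier U ⊆ sphere a r) : U = ball a r := by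
  refine Set.Subset.antisymm ?_ ?_
  · rw [← interior_closedBall a hr.ne']
    refine interior_maximal (fun z hz => ?_) hUo
    rw [mem_closedBall, dist_eq_norm]
    exact Complex.norm_le_of_forall_mem_frontier_norm_le (f := fun w => w - a) hU
      (differentiable_id.sub_const a).diffContOnCl
      (fun w hw => (mem_sphere_iff_norm.mp (h hw)).le) (subset_closure hz)
  · refine isPreconnected_ball.subset_of_closure_inter_subset hUo ⟨a, mem_ball_self hr, ha⟩ ?_
    rintro z ⟨hzU, hz⟩
    by_contra hzU'
    exact (mem_ball.mp hz).ne (mem_sphere.mp (h (hUo.frontier_eq ▸ ⟨hzU, hzU'⟩)))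

/-- The order-one quadrature domain argument from the proof of Theorem 4.2: if the Schwarz
function of the boundary extends meromorphically to `Ω` with a single simple pole at `a`,
then `Ω` is a disk centered at `a`. -/
theorem schwarz_function_simple_pole_disk
    (Ω : Set ℂ) (hne : Ω.Nonempty) (hbd : Bornology.IsBounded Ω)
    (hop : IsOpen Ω) (hconn : IsConnected Ω)
    (a : ℂ) (ha : a ∈ Ω)
    (S : ℂ → ℂ) (hScont : ContinuousOn S (closure Ω \ {a}))
    (hSdiff : ∀ z ∈ Ω \ {a}, DifferentiableAt ℂ S z)
    (hQ : ∃ Q : ℂ → ℂ, ContinuousOn Q (closure Ω) ∧ (∀ z ∈ Ω, DifferentiableAt ℂ Q z) ∧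
      ∀ z ∈ closure Ω \ {a}, Q z = (z - a) * (S z - (starRingEnd ℂ) a))
    (hSbdry : ∀ z ∈ frontier Ω, S z = (starRingEnd ℂ) z) :
    ∃ r : ℝ, 0 < r ∧ Ω = Metric.ball a r := by
  obtain ⟨Q, hQc, hQd, hQS⟩ := hQ
  have hQdc : DiffContOnCl ℂ Q Ω := ⟨fun z hz => (hQd z hz).differentiableWithinAt, hQc⟩
  have hQfr : ∀ z ∈ frontier Ω, Q z = ((‖z - a‖ ^ 2 : ℝ) : ℂ) := by
    intro z hz
    have hza : z ≠ a := by
      rintro rfl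
      exact Set.disjoint_left.mp (disjoint_frontier_iff_isOpen.mpr hop) hz ha
    rw [hQS z ⟨frontier_subset_closure hz, hza⟩, hSbdry z hz, ← map_sub, Complex.mul_conj,
      Complex.normSq_eq_norm_sq]
  have hQim : ∀ z ∈ Ω, (Q z).im = 0 := fun z hz =>
    im_eq_zero_of_forall_mem_frontier_im_eq_zero hbd hQdc
      (fun w hw => by rw [hQfr w hw, Complex.ofReal_im]) (subset_closure hz)
  obtain ⟨c, hc⟩ := (hQdc.differentiableOn.analyticOnNhd hop).eq_const_of_im_eq_const
    hQim hop hconn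
  have hQcl : Set.EqOn Q (fun _ => c) (closure Ω) :=
    Set.EqOn.of_subset_closure hc hQc continuousOn_const subset_closure le_rfl
  have hfne : (frontier Ω).Nonempty := nonempty_frontier_iff.mpr
    ⟨hne, fun h => NormedSpace.unbounded_univ ℂ ℂ (h ▸ hbd)⟩
  obtain ⟨p, hp⟩ := hfne
  have hpa : p ≠ a := by
    rintro rfl
    exact Set.disjoint_left.mp (disjoint_frontier_iff_isOpen.mpr hop) hp ha
  have hpos : 0 < ‖p - a‖ := norm_pos_iff.mpr (sub_ne_zero.mpr hpa)
  refine ⟨‖p - a‖, hpos, eq_ball_of_frontier_subset_sphere hpos hbd hop ha fun z hz => ?_⟩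
  have heq : Q z = Q p :=
    (hQcl (frontier_subset_closure hz)).trans (hQcl (frontier_subset_closure hp)).symm
  rw [hQfr z hz, hQfr p hp, Complex.ofReal_inj] at heq
  exact mem_sphere_iff_norm.mpr
    ((pow_left_inj₀ (norm_nonneg _) (norm_nonneg _) two_ne_zero).mp heq)
end

section
/- Let Q be a polynomial in two variables with complex coefficients (Q ∈ MvPolynomial (Fin 2) ℂ). If the evaluation Q(z, conj z) is a real number for every z ∈ ℂ, then for all z, w ∈ ℂ one has Q(z, conj w) = conj(Q(w, conj z)). -/
open MvPolynomial

/-- A polynomial in two complex variables that vanishes on the antidiagonal `(z, conj z)`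
is zero. -/
theorem MvPolynomial.eq_zero_of_eval_conj_eq_zero {P : MvPolynomial (Fin 2) ℂ}
    (h : ∀ z : ℂ, eval ![z, (starRingEnd ℂ) z] P = 0) : P = 0 := by
  let f : Fin 2 → MvPolynomial (Fin 2) ℂ :=
    ![X 0 + C Complex.I * X 1, X 0 - C Complex.I * X 1]
  have eval_bind (x : Fin 2 → ℂ) : eval x (bind₁ f P) =
      eval ![x 0 + Complex.I * x 1, x 0 - Complex.I * x 1] P := by
    rw [← aeval_eq_eval, ← aeval_eq_eval, aeval_bind₁]
    congr 2
    funext i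
    fin_cases i <;> simp [f]
  have bind_zero : bind₁ f P = 0 := by
    refine funext_set (fun _ => Set.range ((↑) : ℝ → ℂ))
      (fun _ => Set.infinite_range_of_injective Complex.ofReal_injective) fun x hx => ?_
    obtain ⟨a, ha⟩ := hx 0 trivial
    obtain ⟨b, hb⟩ := hx 1 trivial
    have hab := h (a + Complex.I * b)
    simp only [map_add, map_mul, Complex.conj_I, Complex.conj_ofReal, neg_mul,
      ← sub_eq_add_neg] at hab
    rw [eval_bind, ← ha, ← hb, hab, map_zero]
  refine MvPolynomial.funext fun x => ?_
  have hx := eval_bind ![(x 0 + x 1) / 2, -Complex.I * (x 0 - x 1) / 2]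
  rw [bind_zero, map_zero] at hx
  rw [map_zero, hx]
  congr 2
  funext i
  fin_cases i
  · simp
    linear_combination (x 0 - x 1) / 2 * Complex.I_mul_I
  · simp
    linear_combination -(x 0 - x 1) / 2 * Complex.I_mul_I

/-- Identity (3.8) of the paper: if `Q(z, conj z)` is real for all `z`, then
`Q(z, conj w) = conj (Q(w, conj z))` for all `z, w`. -/
theorem real_curve_polynomial_symmetry
    (Q : MvPolynomial (Fin 2) ℂ)
    (hreal : ∀ z : ℂ, (MvPolynomial.eval ![z, (starRingEnd ℂ) z] Q).im = 0) :
    ∀ z w : ℂ, MvPolynomial.eval ![z, (starRingEnd ℂ) w] Q =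
      (starRingEnd ℂ) (MvPolynomial.eval ![w, (starRingEnd ℂ) z] Q) := by
  have eval_conj_swap (z w : ℂ) :
      eval ![z, (starRingEnd ℂ) w] (rename (Equiv.swap 0 1) (map (starRingEnd ℂ) Q)) =
        (starRingEnd ℂ) (eval ![w, (starRingEnd ℂ) z] Q) := by
    rw [eval_rename, map_eval]
    congr 2
    funext i
    fin_cases i <;> simp
  have symm : Q - rename (Equiv.swap 0 1) (map (starRingEnd ℂ) Q) = 0 := by
    refine eq_zero_of_eval_conj_eq_zero fun z => ?_
    rw [map_sub, eval_conj_swap, Complex.conj_eq_iff_im.mpr (hreal z), sub_self]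
  intro z w
  rw [← eval_conj_swap, ← sub_eq_zero.mp symm]
end

section
/- Let Q be a polynomial in two variables with complex coefficients (Q ∈ MvPolynomial (Fin 2) ℂ) such that Q(z, conj z) is a real number for every z ∈ ℂ. Then for all z₁, z₂ ∈ ℂ: Q(z₂, conj z₁) = 0 if and only if Q(z₁, conj z₂) = 0. (Equivalently, z₁ belongs to the set of anticonformal reflections {R(z₂)} = {w : Q(z₂, conj w) = 0} if and only if z₂ belongs to {R(z₁)}.) -/
open MvPolynomial

/-- A complex polynomial in two variables is determined by its values on the
totally real plane of points `(z, conj z)`. -/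
theorem MvPolynomial.eq_of_eval_conj_eq {P Q : MvPolynomial (Fin 2) ℂ}
    (h : ∀ z : ℂ, eval ![z, (starRingEnd ℂ) z] P = eval ![z, (starRingEnd ℂ) z] Q) :
    P = Q := by
  let f : Fin 2 → MvPolynomial (Fin 2) ℂ := ![X 0 + C Complex.I * X 1, X 0 - C Complex.I * X 1]
  have eval_f (x : Fin 2 → ℂ) (R : MvPolynomial (Fin 2) ℂ) :
      eval x (bind₁ f R) = eval ![x 0 + Complex.I * x 1, x 0 - Complex.I * x 1] R := by
    rw [← coe_aeval_eq_eval, ← coe_aeval_eq_eval, RingHom.coe_coe, RingHom.coe_coe, aeval_bind₁]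
    congr 2
    ext i
    fin_cases i <;> simp [f]
  have hf : bind₁ f P = bind₁ f Q := by
    refine funext_set (fun _ ↦ Set.range Complex.ofReal)
      (fun _ ↦ Set.infinite_range_of_injective Complex.ofReal_injective) fun x hx ↦ ?_
    obtain ⟨a, ha⟩ := hx 0 trivial
    obtain ⟨b, hb⟩ := hx 1 trivial
    simpa [eval_f, ← ha, ← hb, sub_eq_add_neg] using h (a + Complex.I * b)
  refine funext fun x ↦ ?_
  have hx : x = ![(x 0 + x 1) / 2 + Complex.I * (-Complex.I * (x 0 - x 1) / 2),
      (x 0 + x 1) / 2 - Complex.I * (-Complex.I * (x 0 - x 1) / 2)] := by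
    ext i
    fin_cases i <;> simp only [Fin.zero_eta, Fin.mk_one, Matrix.cons_val_zero, Matrix.cons_val_one]
    · linear_combination ((x 0 - x 1) / 2) * Complex.I_sq
    · linear_combination -((x 0 - x 1) / 2) * Complex.I_sq
  have := congrArg (eval ![(x 0 + x 1) / 2, -Complex.I * (x 0 - x 1) / 2]) hf
  rw [eval_f, eval_f] at this
  rw [hx]
  exact this

/-- A polynomial that is real on the plane of points `(z, conj z)` is Hermitian symmetric. -/
theorem MvPolynomial.conj_eval_of_eval_conj_im_eq_zero {Q : MvPolynomial (Fin 2) ℂ}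
    (hreal : ∀ z : ℂ, (eval ![z, (starRingEnd ℂ) z] Q).im = 0) (z w : ℂ) :
    (starRingEnd ℂ) (eval ![z, (starRingEnd ℂ) w] Q) = eval ![w, (starRingEnd ℂ) z] Q := by
  have eval_adjoint (z w : ℂ) :
      eval ![w, (starRingEnd ℂ) z] (rename (Equiv.swap 0 1) (map (starRingEnd ℂ) Q)) =
        (starRingEnd ℂ) (eval ![z, (starRingEnd ℂ) w] Q) := by
    rw [eval_rename, eval_map, ← eval₂_id, ← RingHom.comp_id (starRingEnd ℂ), hom_eval₂]
    congr 1
    ext i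
    fin_cases i <;> simp
  rw [← eval_adjoint]
  congr 1
  refine eq_of_eval_conj_eq fun u ↦ ?_
  rw [eval_adjoint, Complex.conj_eq_iff_im]
  exact hreal u

/-- The Reciprocity Theorem of Section 3.1.1: for a real algebraic curve
`{z : Q(z, conj z) = 0}`, the point `z₁` is an anticonformal reflection of `z₂` if and
only if `z₂` is an anticonformal reflection of `z₁`. -/
theorem reciprocity_theorem
    (Q : MvPolynomial (Fin 2) ℂ)
    (hreal : ∀ z : ℂ, (MvPolynomial.eval ![z, (starRingEnd ℂ) z] Q).im = 0) :
    ∀ z₁ z₂ : ℂ, MvPolynomial.eval ![z₂, (starRingEnd ℂ) z₁] Q = 0 ↔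
      MvPolynomial.eval ![z₁, (starRingEnd ℂ) z₂] Q = 0 := by
  intro z₁ z₂
  rw [← conj_eval_of_eval_conj_im_eq_zero hreal z₁ z₂, map_eq_zero]
end

section
/- Let p and q be complex polynomials, let U ⊆ ℂ be an open set containing the closed unit disk on which q has no zeros, and suppose φ := p/q is injective on U. Set Ω := φ '' (ball 0 1). Suppose t belongs to the frontier of Ω and ζ ∈ ℂ satisfies q(ζ) ≠ 0 and φ(ζ) = t. Then either ‖ζ‖ = 1, in which case 1/conj(ζ) = ζ and φ(1/conj(ζ)) = t lies on the frontier of Ω, or ‖ζ‖ > 1 and φ(1/conj(ζ)) ∈ Ω. -/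
open Metric Polynomial

/-- A nonconstant (here: injective) rational function without poles in the unit disk maps the
disk onto an open set. -/
lemma isOpen_image_ball_of_injOn_div (p q : Polynomial ℂ) (φ : ℂ → ℂ)
    (hφ : ∀ z, φ z = p.eval z / q.eval z) (hq : ∀ z ∈ ball (0 : ℂ) 1, q.eval z ≠ 0)
    (hinj : Set.InjOn φ (ball (0 : ℂ) 1)) : IsOpen (φ '' ball (0 : ℂ) 1) := by
  have hdiff : DifferentiableOn ℂ φ (ball (0 : ℂ) 1) := by
    rw [show φ = fun z => p.eval z / q.eval z from funext hφ]
    exact p.differentiable.differentiableOn.div q.differentiable.differentiableOn hq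
  rcases (hdiff.analyticOnNhd isOpen_ball).is_constant_or_isOpen
    (convex_ball (0 : ℂ) 1).isPreconnected with ⟨w, hw⟩ | hopen
  · have h0 : (0 : ℂ) ∈ ball (0 : ℂ) 1 := by simp
    have h1 : (1 / 2 : ℂ) ∈ ball (0 : ℂ) 1 := by norm_num
    have h := hinj h0 h1 ((hw 0 h0).trans (hw _ h1).symm)
    norm_num at h
  · exact hopen _ subset_rfl isOpen_ball



/-- Lemma 3.12 (ii): for an R-domain `Ω = φ(𝔻)` and a boundary point `t = φ(ζ)`, either
`ζ` is on the unit circle, in which case the anticonformal reflection `φ(1/conj ζ)` is `t`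
itself (on the frontier), or `ζ` lies outside the closed disk and the reflection lies
in `Ω`. -/
theorem acr_boundary_point_reflections
    (p q : Polynomial ℂ)
    (U : Set ℂ) (hU : IsOpen U) (hUball : closedBall (0 : ℂ) 1 ⊆ U)
    (hq : ∀ z ∈ U, q.eval z ≠ 0)
    (φ : ℂ → ℂ) (hφ : ∀ z, φ z = p.eval z / q.eval z)
    (hinj : Set.InjOn φ U)
    (Ω : Set ℂ) (hΩ : Ω = φ '' ball (0 : ℂ) 1)
    (t : ℂ) (ht : t ∈ frontier Ω)
    (ζ : ℂ) (hqζ : q.eval ζ ≠ 0) (hζt : φ ζ = t) :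
    (‖ζ‖ = 1 ∧ 1 / (starRingEnd ℂ) ζ = ζ ∧
      φ (1 / (starRingEnd ℂ) ζ) = t ∧ φ (1 / (starRingEnd ℂ) ζ) ∈ frontier Ω) ∨
    (1 < ‖ζ‖ ∧ φ (1 / (starRingEnd ℂ) ζ) ∈ Ω) := by
  have hballU : ball (0 : ℂ) 1 ⊆ U := ball_subset_closedBall.trans hUball
  have hopen : IsOpen Ω := hΩ ▸ isOpen_image_ball_of_injOn_div p q φ hφ
    (fun z hz => hq z (hballU hz)) (hinj.mono hballU)
  have hle : 1 ≤ ‖ζ‖ := by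
    by_contra! hlt
    have htΩ : t ∈ Ω := by
      rw [hΩ]
      exact ⟨ζ, by simpa using hlt, hζt⟩
    rw [hopen.frontier_eq] at ht
    exact ht.2 htΩ
  rcases hle.eq_or_lt with heq | hlt
  · have hconj : 1 / (starRingEnd ℂ) ζ = ζ := by
      have hne : (starRingEnd ℂ) ζ ≠ 0 := by
        rw [← norm_ne_zero_iff, RCLike.norm_conj, ← heq]
        exact one_ne_zero
      rw [div_eq_iff hne, Complex.mul_conj']
      simp [← heq]
    rw [hconj, hζt]
    exact Or.inl ⟨heq.symm, rfl, rfl, ht⟩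
  · refine Or.inr ⟨hlt, ?_⟩
    rw [hΩ]
    refine ⟨_, ?_, rfl⟩
    rw [mem_ball_zero_iff, norm_div, norm_one, RCLike.norm_conj]
    exact (div_lt_one (by linarith)).2 hlt
end

section
/- Let p and q be complex polynomials with max(deg p, deg q) ≥ 1, let U ⊆ ℂ be an open set containing the closed unit disk on which q has no zeros, and suppose φ := p/q is injective on U. Set Ω := φ '' (ball 0 1). Then there exist a finite set T ⊆ Ω and a function S : ℂ → ℂ such that S is continuous on (closure Ω) ∖ T, complex-differentiable at every point of Ω ∖ T, and S(z) = conj(z) for every z in the frontier of Ω. -/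
open Metric Polynomial
open Filter Topology ComplexConjugate

/-- The inverse on `U` of an injective analytic function is continuous, and the function is a
local right inverse of it. -/
lemma invFunOn_continuousAt_of_injOn {U : Set ℂ} (hU : IsOpen U) {f : ℂ → ℂ}
    (hinj : Set.InjOn f U) {z : ℂ} (hz : z ∈ U) (hf : AnalyticAt ℂ f z) :
    ContinuousAt (Function.invFunOn f U) (f z) ∧
      ∀ᶠ w in 𝓝 (f z), f (Function.invFunOn f U w) = w := by
  have hUz : U ∈ 𝓝 z := hU.mem_nhds hz
  have hmap : 𝓝 (f z) ≤ map f (𝓝 z) := by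
    refine hf.eventually_constant_or_nhds_le_map_nhds.resolve_left fun hconst => ?_
    have hsing : ∀ᶠ y in 𝓝 z, y = z := by
      filter_upwards [hconst, hUz] with y hy hyU using hinj hyU hz hy
    exact (hsing.filter_mono nhdsWithin_le_nhds).and self_mem_nhdsWithin
      |>.exists (f := 𝓝[≠] z) |>.elim fun y hy => hy.2 hy.1
  have hleft := hinj.leftInvOn_invFunOn
  constructor
  · rw [ContinuousAt, hleft hz]
    refine Tendsto.mono_left (tendsto_map'_iff.2 ?_) hmap
    refine tendsto_id.congr' ?_
    filter_upwards [hUz] with y hy using (hleft hy).symm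
  · refine hmap (eventually_map.2 ?_)
    filter_upwards [hUz] with y hy
    rw [hleft hy]

/-- The image of an open set on which an analytic function is injective is open. -/
lemma isOpen_image_of_injOn {U V : Set ℂ} (hU : IsOpen U) (hV : IsOpen V) (hVU : V ⊆ U)
    {f : ℂ → ℂ} (hinj : Set.InjOn f U) (hf : ∀ z ∈ U, AnalyticAt ℂ f z) :
    IsOpen (f '' V) := by
  rw [isOpen_iff_mem_nhds]
  rintro _ ⟨z, hz, rfl⟩
  obtain ⟨hcont, hright⟩ := invFunOn_continuousAt_of_injOn hU hinj (hVU hz) (hf z (hVU hz))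
  have hmem : V ∈ 𝓝 (Function.invFunOn f U (f z)) := by
    rw [hinj.leftInvOn_invFunOn (hVU hz)]
    exact hV.mem_nhds hz
  filter_upwards [hcont hmem, hright] with w hw hw'
  exact ⟨_, hw, hw'⟩

/-- For a quotient `p / q` injective on a neighbourhood of the unit disk, the numerator of the
derivative is not the zero polynomial. -/
lemma wronskian_ne_zero_of_injOn_ball {p q : ℂ[X]} (hq : ∀ z ∈ ball (0 : ℂ) 1, q.eval z ≠ 0)
    (hinj : Set.InjOn (fun z => p.eval z / q.eval z) (ball (0 : ℂ) 1)) :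
    derivative p * q - p * derivative q ≠ 0 := by
  intro h
  have hderiv : ∀ z ∈ ball (0 : ℂ) 1, HasDerivAt (fun z => p.eval z / q.eval z) 0 z := by
    intro z hz
    have hd := (p.hasDerivAt z).div (q.hasDerivAt z) (hq z hz)
    have hnum := congrArg (Polynomial.eval z) h
    simp only [eval_sub, eval_mul, eval_zero] at hnum
    rwa [hnum, zero_div] at hd
  have h0 : (0 : ℂ) ∈ ball (0 : ℂ) 1 := by simp
  have h2 : (1 / 2 : ℂ) ∈ ball (0 : ℂ) 1 := by simp; norm_num
  have hconst := isOpen_ball.is_const_of_deriv_eq_zero (convex_ball (0 : ℂ) 1).isPreconnected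
    (fun z hz => (hderiv z hz).differentiableAt.differentiableWithinAt)
    (fun z hz => (hderiv z hz).deriv) h0 h2
  have := hinj h0 h2 hconst
  norm_num at this

/-- For an R-domain `Ω = φ(𝔻)`, the Schwarz function of `∂Ω` continues meromorphically
(holomorphically off a finite set of poles) into all of `Ω`; used in the proof of
Theorem 3.19. -/
theorem rdomain_schwarz_function_meromorphic
    (p q : Polynomial ℂ) (hdeg : 1 ≤ max p.natDegree q.natDegree)
    (U : Set ℂ) (hU : IsOpen U) (hUball : closedBall (0 : ℂ) 1 ⊆ U)
    (hq : ∀ z ∈ U, q.eval z ≠ 0)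
    (φ : ℂ → ℂ) (hφ : ∀ z, φ z = p.eval z / q.eval z)
    (hinj : Set.InjOn φ U)
    (Ω : Set ℂ) (hΩ : Ω = φ '' ball (0 : ℂ) 1) :
    ∃ T : Set ℂ, T.Finite ∧ T ⊆ Ω ∧
      ∃ S : ℂ → ℂ, ContinuousOn S (closure Ω \ T) ∧
        (∀ z ∈ Ω \ T, DifferentiableAt ℂ S z) ∧
        ∀ z ∈ frontier Ω, S z = (starRingEnd ℂ) z := by
  obtain rfl : φ = fun z => p.eval z / q.eval z := funext hφ
  set φ : ℂ → ℂ := fun z => p.eval z / q.eval z with hφdef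
  set ψ := Function.invFunOn φ U
  have hballU : ball (0 : ℂ) 1 ⊆ U := ball_subset_closedBall.trans hUball
  have hdiff : ∀ z, q.eval z ≠ 0 → DifferentiableAt ℂ φ z := fun z hz =>
    p.differentiable.differentiableAt.div q.differentiable.differentiableAt hz
  have han : ∀ z ∈ U, AnalyticAt ℂ φ z := fun z hz =>
    DifferentiableOn.analyticAt (fun y hy => (hdiff y (hq y hy)).differentiableWithinAt)
      (hU.mem_nhds hz)
  have hψ : ∀ z ∈ U, ψ (φ z) = z := fun z hz => hinj.leftInvOn_invFunOn hz
  have hq0 : q ≠ 0 := by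
    rintro rfl
    exact hq 0 (hballU (by simp)) eval_zero
  have hW := wronskian_ne_zero_of_injOn_ball (fun z hz => hq z (hballU hz)) (hinj.mono hballU)
  set W := derivative p * q - p * derivative q with hWdef
  have hcl : closure Ω ⊆ φ '' closedBall 0 1 := by
    have hc : IsCompact (φ '' closedBall 0 1) :=
      (isCompact_closedBall 0 1).image_of_continuousOn fun z hz =>
        (hdiff z (hq z (hUball hz))).continuousAt.continuousWithinAt
    exact closure_minimal (hΩ ▸ Set.image_mono ball_subset_closedBall) hc.isClosed
  have hΩo : IsOpen Ω := hΩ ▸ isOpen_image_of_injOn hU isOpen_ball hballU hinj han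
  set A : Set ℂ := {ζ ∈ ball (0 : ℂ) 1 | ζ = 0 ∨ q.eval (conj ζ)⁻¹ = 0 ∨ W.eval ζ = 0} with hA
  have hAfin : A.Finite := by
    have hinjr : Function.Injective fun ζ : ℂ => (conj ζ)⁻¹ :=
      inv_injective.comp (starRingEnd ℂ).injective
    refine ((Set.finite_singleton (0 : ℂ)).union
      (((finite_setOfPred_isRoot hq0).preimage hinjr.injOn).union
        (finite_setOfPred_isRoot hW))).subset ?_
    rintro ζ ⟨-, h | h | h⟩
    · exact Or.inl h
    · exact Or.inr (Or.inl h)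
    · exact Or.inr (Or.inr h)
  have hreflect : ∀ ζ : ℂ, ‖ζ‖ = 1 → (conj ζ)⁻¹ = ζ := fun ζ hζ => by
    rw [← Complex.inv_eq_conj hζ, inv_inv]
  have hR : ∀ ζ : ℂ, ζ ≠ 0 → q.eval (conj ζ)⁻¹ ≠ 0 →
      DifferentiableAt ℂ (fun ζ => conj (φ (conj ζ)⁻¹)) ζ := fun ζ h0 h1 => by
    have hc : conj ζ ≠ 0 := by simpa using h0
    have hd : DifferentiableAt ℂ (fun z => φ z⁻¹) (conj ζ) :=
      (hdiff _ h1).comp (conj ζ) (differentiableAt_inv hc)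
    simpa [Function.comp_def] using hd.conj_conj
  refine ⟨φ '' A, hAfin.image φ, hΩ ▸ Set.image_mono (Set.sep_subset _ _),
    fun w => conj (φ (conj (ψ w))⁻¹), ?_, ?_, ?_⟩
  · rintro w ⟨hw, hwT⟩
    obtain ⟨ζ, hζ, rfl⟩ := hcl hw
    have hζU := hUball hζ
    have hζA : ζ ∉ A := fun h => hwT ⟨ζ, h, rfl⟩
    have hreg : ζ ≠ 0 ∧ q.eval (conj ζ)⁻¹ ≠ 0 := by
      rcases (mem_closedBall_zero_iff.1 hζ).lt_or_eq with hlt | heq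
      · exact ⟨fun h => hζA ⟨mem_ball_zero_iff.2 hlt, Or.inl h⟩,
          fun h => hζA ⟨mem_ball_zero_iff.2 hlt, Or.inr (Or.inl h)⟩⟩
      · refine ⟨fun h => by simp [h] at heq, ?_⟩
        rw [hreflect ζ heq]
        exact hq ζ hζU
    have hcont := (hR ζ hreg.1 hreg.2).continuousAt
    rw [← hψ ζ hζU] at hcont
    exact (ContinuousAt.comp (f := ψ) hcont
      (invFunOn_continuousAt_of_injOn hU hinj hζU (han ζ hζU)).1).continuousWithinAt
  · rintro w ⟨hw, hwT⟩
    obtain ⟨ζ, hζ, rfl⟩ : w ∈ φ '' ball 0 1 := hΩ ▸ hw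
    have hζU := hballU hζ
    have hζA : ζ ∉ A := fun h => hwT ⟨ζ, h, rfl⟩
    have hd := hR ζ (fun h => hζA ⟨hζ, Or.inl h⟩) (fun h => hζA ⟨hζ, Or.inr (Or.inl h)⟩)
    have hW' : W.eval ζ ≠ 0 := fun h => hζA ⟨hζ, Or.inr (Or.inr h)⟩
    obtain ⟨hcont, hright⟩ := invFunOn_continuousAt_of_injOn hU hinj hζU (han ζ hζU)
    have hφ' := (p.hasDerivAt ζ).fun_div (q.hasDerivAt ζ) (hq ζ hζU)
    have hne : (eval ζ (derivative p) * eval ζ q - eval ζ p * eval ζ (derivative q)) /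
        eval ζ q ^ 2 ≠ 0 :=
      div_ne_zero (by simpa [hWdef] using hW') (pow_ne_zero 2 (hq ζ hζU))
    have hψ' := HasDerivAt.of_local_left_inverse hcont
      (f := φ) (by rw [show Function.invFunOn φ U (φ ζ) = ζ from hψ ζ hζU]; exact hφ') hne hright
    rw [← hψ ζ hζU] at hd
    exact DifferentiableAt.comp (f := ψ) (φ ζ) hd hψ'.differentiableAt
  · intro w hw
    rw [hΩo.frontier_eq] at hw
    obtain ⟨ζ, hζ, rfl⟩ := hcl hw.1
    have hnorm : ‖ζ‖ = 1 := by
      refine (mem_closedBall_zero_iff.1 hζ).eq_of_not_lt fun hlt => hw.2 ?_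
      rw [hΩ]
      exact ⟨ζ, mem_ball_zero_iff.2 hlt, rfl⟩
    simp only [hψ ζ (hUball hζ), hreflect ζ hnorm]
end

section
/- Let Ω ⊆ ℂ be a nonempty bounded open connected set and let (f, g) be a matching pair for Ω with f nonconstant on Ω. Then for every integer n ≥ 1 the pair (f^n, g^n) is again a matching pair for Ω, and the family of restrictions to Γ = frontier Ω of the powers f, f^2, f^3, … is linearly independent over ℂ (as elements of the space of functions Γ → ℂ). In particular, the ℂ-linear span of boundary restrictions of first components of matching pairs for Ω is infinite-dimensional. -/
open Metric Filter

/-- Powers of a matching pair with positive exponent form a matching pair. -/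
theorem IsMatchingPair.pow {Ω : Set ℂ} {f g : ℂ → ℂ} (h : IsMatchingPair Ω f g) {n : ℕ}
    (hn : 1 ≤ n) : IsMatchingPair Ω (fun z => f z ^ n) (fun z => g z ^ n) := by
  obtain ⟨hfc, hfd, hgc, hgd, hg0, heq⟩ := h
  refine ⟨hfc.pow n, fun z hz => (hfd z hz).fun_pow n, hgc.pow n,
    fun z hz => (hgd z hz).fun_pow n, ?_, fun z hz => ?_⟩
  · simpa [zero_pow (Nat.one_le_iff_ne_zero.mp hn)] using hg0.pow n
  · simp [heq z hz]

/-- A continuous function on a connected set whose values are roots of a nonzero polynomial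
is constant there. -/
theorem IsPreconnected.exists_eq_const_of_eval_eq_zero {Ω : Set ℂ} (hΩ : IsPreconnected Ω)
    {f : ℂ → ℂ} (hf : ContinuousOn f Ω) {p : Polynomial ℂ} (hp : p ≠ 0)
    (h : ∀ z ∈ Ω, p.eval (f z) = 0) : ∃ k : ℂ, ∀ z ∈ Ω, f z = k := by
  have hfin : (f '' Ω).Finite := by
    refine (Polynomial.finite_setOfPred_isRoot hp).subset ?_
    rintro _ ⟨z, hz, rfl⟩
    exact h z hz
  have hsub := hfin.countable.isTotallyDisconnected _ subset_rfl (hΩ.image f hf)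
  obtain hempty | ⟨k, hk⟩ := hsub.eq_empty_or_singleton
  · exact ⟨0, fun z hz => absurd (Set.mem_image_of_mem f hz) (by simp [hempty])⟩
  · exact ⟨k, fun z hz => by simpa [hk] using Set.mem_image_of_mem f hz⟩

/-- The powers of a transcendental element are linearly independent. -/
theorem Transcendental.linearIndependent_pow {R A : Type*} [CommRing R] [Ring A] [Algebra R A]
    {x : A} (hx : Transcendental R x) : LinearIndependent R (fun n : ℕ => x ^ n) := by
  have h := (Polynomial.basisMonomials R).linearIndependent.map'
    (Polynomial.aeval x).toLinearMap
    (LinearMap.ker_eq_bot.mpr (transcendental_iff_injective.mp hx))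
  simpa [Function.comp_def, Polynomial.aeval_monomial] using h

/-- The boundary values of a nonconstant function, holomorphic on a bounded connected set and
continuous up to the boundary, are transcendental over `ℂ`. -/
theorem transcendental_domRestrict_frontier {Ω : Set ℂ} (hbd : Bornology.IsBounded Ω)
    (hconn : IsPreconnected Ω) {f : ℂ → ℂ}
    (hfc : ContinuousOn f (closure Ω)) (hfd : ∀ z ∈ Ω, DifferentiableAt ℂ f z)
    (hnc : ¬ ∃ k : ℂ, ∀ z ∈ Ω, f z = k) :
    Transcendental ℂ ((frontier Ω).domRestrict f) := by
  rintro ⟨p, hp, hpf⟩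
  refine hnc (hconn.exists_eq_const_of_eval_eq_zero (hfc.mono subset_closure) hp ?_)
  have hd : DiffContOnCl ℂ (fun z => p.eval (f z)) Ω :=
    ⟨fun z hz => (p.differentiableAt.comp z (hfd z hz)).differentiableWithinAt,
      p.continuous.comp_continuousOn hfc⟩
  have hfr : Set.EqOn (fun z => p.eval (f z)) (fun _ => 0) (frontier Ω) := fun z hz => by
    have hz' := congrFun hpf ⟨z, hz⟩
    rwa [Polynomial.aeval_fn_apply] at hz'
  exact fun z hz =>
    Complex.eqOn_of_eqOn_frontier hbd hd diffContOnCl_const hfr hz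

/-- Corollary 1.22: if the matching problem for `Ω` has a nonconstant solution `(f, g)`,
then all powers `(fⁿ, gⁿ)` are matching pairs, the boundary restrictions of the powers of
`f` are linearly independent, and hence the span of boundary restrictions of first
components of matching pairs is infinite-dimensional. -/
theorem matching_pairs_infinite_dimensional
    (Ω : Set ℂ) (hne : Ω.Nonempty) (hbd : Bornology.IsBounded Ω)
    (hop : IsOpen Ω) (hconn : IsConnected Ω)
    (f g : ℂ → ℂ) (hfg : IsMatchingPair Ω f g)
    (hnc : ¬ ∃ k : ℂ, ∀ z ∈ Ω, f z = k) :
    (∀ n : ℕ, 1 ≤ n →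
      IsMatchingPair Ω (fun z => f z ^ n) (fun z => g z ^ n)) ∧
    LinearIndependent ℂ
      (fun n : ℕ => (frontier Ω).restrict (fun z => f z ^ (n + 1))) ∧
    ¬ Module.Finite ℂ
      (Submodule.span ℂ {h : frontier Ω → ℂ |
        ∃ f' g' : ℂ → ℂ, IsMatchingPair Ω f' g' ∧ h = (frontier Ω).restrict f'}) := by
  have hli : LinearIndependent ℂ
      (fun n : ℕ => (frontier Ω).restrict (fun z => f z ^ (n + 1))) :=
    (transcendental_domRestrict_frontier hbd hconn.isPreconnected hfg.1 hfg.2.1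
      hnc).linearIndependent_pow.comp Nat.succ Nat.succ_injective
  refine ⟨fun n hn => hfg.pow hn, hli, fun hfin => ?_⟩
  have hmem (n : ℕ) : (frontier Ω).restrict (fun z => f z ^ (n + 1)) ∈
      Submodule.span ℂ {h : frontier Ω → ℂ |
        ∃ f' g' : ℂ → ℂ, IsMatchingPair Ω f' g' ∧ h = (frontier Ω).restrict f'} :=
    Submodule.subset_span ⟨_, _, hfg.pow (Nat.succ_pos n), rfl⟩
  have hli' : LinearIndependent ℂ (fun n : ℕ => (⟨_, hmem n⟩ : Submodule.span ℂ _)) :=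
    LinearIndependent.of_comp (Submodule.subtype _) hli
  exact not_finite_iff_infinite.mpr inferInstance hli'.finite
end
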